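/- Suppose that for every pair of Euclidean lattices (E, L) and (F, M) which are both semistable and isodual, H_min of their tensor product equals H_min(E, L)·H_min(F, M). Then the same equality holds for every pair of Euclidean lattices (E, L) and (F, M). -/

import Mathlib

open Module

noncomputable section

namespace EucLat

variable {E : Type*} [NormedAddCommGroup E] [InnerProductSpace ℝ E]

/-- The covolume of a `ℤ`-submodule of a real inner product space: the square root of the
Gram determinant of a `ℤ`-basis (junk value `0` if no finite basis exists). -/
def covol (L : Submodule ℤ E) : ℝ :=
  @dite _ (∃ n : ℕ, Nonempty (Basis (Fin n) ℤ L)) (Classical.propDecidable _)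
    (fun h => Real.sqrt (Matrix.det (Matrix.of fun i j =>
      (inner ℝ ((h.choose_spec.some i : L) : E) ((h.choose_spec.some j : L) : E) : ℝ))))
    (fun _ => 0)

/-- The reduced height `covol(L)^(1/dim E)` of a full lattice. -/
def redH (L : Submodule ℤ E) : ℝ := covol L ^ ((finrank ℝ E : ℝ)⁻¹)

/-- The lattice `L ∩ F` induced on a subspace `F`. -/
def latIn (L : Submodule ℤ E) (F : Submodule ℝ E) : Submodule ℤ F :=
  L.comap (F.subtype.restrictScalars ℤ)

/-- The reduced height of a subspace: `covol(F ∩ L)^(1/dim F)`. -/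
def Hr (L : Submodule ℤ E) (F : Submodule ℝ E) : ℝ := redH (latIn L F)

/-- A subspace is rational if it is spanned by its intersection with the lattice. -/
def IsRational (L : Submodule ℤ E) (F : Submodule ℝ E) : Prop :=
  Submodule.span ℝ ((L : Set E) ∩ (F : Set E)) = F

/-- `(E, L)` is a Euclidean lattice: `L` is discrete and spans `E` over `ℝ`. -/
def IsLat (L : Submodule ℤ E) : Prop :=
  DiscreteTopology L ∧ Submodule.span ℝ (L : Set E) = ⊤

/-- Minimal reduced height: infimum of reduced heights of nonzero rational subspaces. -/
def Hmin (L : Submodule ℤ E) : ℝ :=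
  sInf {h : ℝ | ∃ F : Submodule ℝ E, F ≠ ⊥ ∧ IsRational L F ∧ h = Hr L F}

/-- Semistability of a Euclidean lattice. -/
def Semistable (L : Submodule ℤ E) : Prop :=
  ∀ F : Submodule ℝ E, F ≠ ⊥ → IsRational L F → redH L ≤ Hr L F

/-- Stability of a Euclidean lattice. -/
def Stable (L : Submodule ℤ E) : Prop :=
  Semistable L ∧ ∀ F : Submodule ℝ E, F ≠ ⊥ → F ≠ ⊤ → IsRational L F → redH L < Hr L F

/-- The quotient lattice of `(E, L)` by a subspace `F`: the image of `L` under the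
orthogonal projection of `E` onto `Fᗮ`. -/
def quotLat [FiniteDimensional ℝ E] (L : Submodule ℤ E) (F : Submodule ℝ E) :
    Submodule ℤ Fᗮ :=
  L.map ((Submodule.orthogonalProjectionOnto Fᗮ : E →ₗ[ℝ] Fᗮ).restrictScalars ℤ)

/-- For subspaces `F ≤ F'`, the successive quotient lattice: the image of `F' ∩ L` under the
orthogonal projection of `F'` onto the orthogonal complement of `F` inside `F'`. -/
def succQuot [FiniteDimensional ℝ E] (L : Submodule ℤ E) (F F' : Submodule ℝ E) :
    Submodule ℤ ((F.comap F'.subtype)ᗮ) :=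
  quotLat (latIn L F') (F.comap F'.subtype)

/-- A GS-flag of `(E, L)`. -/
def IsGSFlag [FiniteDimensional ℝ E] (L : Submodule ℤ E) {ℓ : ℕ}
    (C : Fin (ℓ + 1) → Submodule ℝ E) : Prop :=
  C 0 = ⊥ ∧ C (Fin.last ℓ) = ⊤ ∧
  (∀ i : Fin ℓ, C i.castSucc < C i.succ) ∧
  (∀ i, IsRational L (C i)) ∧
  (∀ i : Fin ℓ, Semistable (succQuot L (C i.castSucc) (C i.succ))) ∧
  (∀ i j : Fin ℓ, i < j →
    redH (succQuot L (C i.castSucc) (C i.succ)) < redH (succQuot L (C j.castSucc) (C j.succ)))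

/-- The dual lattice `L* = {y : ⟪x, y⟫ ∈ ℤ for all x ∈ L}`. -/
def dualLat (L : Submodule ℤ E) : Submodule ℤ E where
  carrier := {y | ∀ x ∈ L, ∃ n : ℤ, (inner ℝ x y : ℝ) = n}
  zero_mem' := fun x _ => ⟨0, by simp⟩
  add_mem' := by
    intro a b ha hb x hx
    obtain ⟨m, hm⟩ := ha x hx
    obtain ⟨n, hn⟩ := hb x hx
    exact ⟨m + n, by rw [inner_add_right, hm, hn]; push_cast; ring⟩
  smul_mem' := by
    intro z y hy x hx
    obtain ⟨n, hn⟩ := hy x hx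
    refine ⟨z * n, ?_⟩
    rw [← Int.cast_smul_eq_zsmul ℝ, real_inner_smul_right, hn]
    push_cast; ring

/-- `(E, L)` is isodual via the similarity `τ`. -/
def IsIsodual (L : Submodule ℤ E) (τ : E →ₗ[ℝ] E) : Prop :=
  (∃ α : ℝ, 0 < α ∧ ∀ x y : E, (inner ℝ (τ x) (τ y) : ℝ) = α * inner ℝ x y) ∧
  L.map (τ.restrictScalars ℤ) = dualLat L

/-- The bilinear form `b_τ(x, y) = ⟪τ x, y⟫` associated with an isoduality. -/
def bform (τ : E →ₗ[ℝ] E) (x y : E) : ℝ := inner ℝ (τ x) y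

/-- `b` has signature `s`: there is a `b`-orthogonal basis with `p - q = s`. -/
def HasSignature (b : E → E → ℝ) (s : ℤ) : Prop :=
  ∃ (n : ℕ) (v : Basis (Fin n) ℝ E),
    (∀ i j, i ≠ j → b (v i) (v j) = 0) ∧
    s = ((Finset.univ.filter fun i => 0 < b (v i) (v i)).card : ℤ) -
        ((Finset.univ.filter fun i => b (v i) (v i) < 0).card : ℤ)

/-- The destabilizing subspace of `(E, L)`. -/
def IsDestabilizing (L : Submodule ℤ E) (F : Submodule ℝ E) : Prop :=
  F ≠ ⊥ ∧ IsRational L F ∧ Hr L F = Hmin L ∧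
  ∀ F' : Submodule ℝ E, F' ≠ ⊥ → IsRational L F' → Hr L F' = Hmin L → F' ≤ F

/-- `(G, t)` is a realization of the tensor product of the inner product spaces `E` and `F`:
`t` induces a linear isomorphism `E ⊗ F ≃ G` and
`⟪t x y, t x' y'⟫ = ⟪x, x'⟫ * ⟪y, y'⟫` on pure tensors. -/
def IsTensor {F G : Type*} [NormedAddCommGroup F] [InnerProductSpace ℝ F]
    [NormedAddCommGroup G] [InnerProductSpace ℝ G] (t : E →ₗ[ℝ] F →ₗ[ℝ] G) : Prop :=
  Function.Bijective (TensorProduct.lift t) ∧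
  ∀ (x x' : E) (y y' : F),
    (inner ℝ (t x y) (t x' y') : ℝ) = (inner ℝ x x' : ℝ) * (inner ℝ y y' : ℝ)

/-- The tensor product lattice `L·M`: the additive subgroup generated by pure tensors. -/
def tensorLat {F G : Type*} [NormedAddCommGroup F] [InnerProductSpace ℝ F]
    [NormedAddCommGroup G] [InnerProductSpace ℝ G] (t : E →ₗ[ℝ] F →ₗ[ℝ] G)
    (L : Submodule ℤ E) (M : Submodule ℤ F) : Submodule ℤ G :=
  Submodule.span ℤ (Set.image2 (fun x y => t x y) (L : Set E) (M : Set F))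

/-- `g` is an automorphism of the Euclidean lattice `(E, L)`. -/
def IsAut (L : Submodule ℤ E) (g : E ≃ₗ[ℝ] E) : Prop :=
  (∀ x, x ∈ L ↔ g x ∈ L) ∧ ∀ x y : E, (inner ℝ (g x) (g y) : ℝ) = inner ℝ x y

/-- The direct product lattice `L × L'` inside `WithLp 2 (E × E')`. -/
def prodLat {E' : Type*} [NormedAddCommGroup E'] [InnerProductSpace ℝ E']
    (L : Submodule ℤ E) (L' : Submodule ℤ E') : Submodule ℤ (WithLp 2 (E × E')) :=
  (L.prod L').comap (((WithLp.linearEquiv 2 ℝ (E × E')).restrictScalars ℤ) : WithLp 2 (E × E') →ₗ[ℤ] E × E')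

set_option linter.unusedSectionVars false


section Gram
variable {ι κ : Type*} [Fintype ι] [DecidableEq ι] [Fintype κ] [DecidableEq κ]

/-- Gram determinant of a finite family. -/
def gd (v : ι → E) : ℝ := (Matrix.gram ℝ v).det

theorem gd_nonneg (v : ι → E) : 0 ≤ gd v := (Matrix.posSemidef_gram ℝ v).det_nonneg

theorem gd_pos_iff (v : ι → E) : 0 < gd v ↔ LinearIndependent ℝ v := by
  rw [← Matrix.det_gram_ne_zero_iff_linearIndependent (𝕜 := ℝ)]
  exact (gd_nonneg v).lt_iff_ne'

theorem gram_lin (A : Matrix κ ι ℝ) (w : ι → E) :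
    Matrix.gram ℝ (fun i => ∑ j, A i j • w j) = A * Matrix.gram ℝ w * A.transpose := by
  ext i k
  simp only [Matrix.gram_apply, Matrix.mul_apply, Matrix.transpose_apply, sum_inner, inner_sum,
    real_inner_smul_left, real_inner_smul_right, Finset.sum_mul]
  refine Finset.sum_congr rfl fun x _ => Finset.sum_congr rfl fun y _ => ?_
  rw [real_inner_comm]; ring

theorem gd_lin (A : Matrix ι ι ℝ) (w : ι → E) :
    gd (fun i => ∑ j, A i j • w j) = A.det ^ 2 * gd w := by
  rw [gd, gram_lin, Matrix.det_mul, Matrix.det_mul, Matrix.det_transpose, gd]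
  ring

theorem gd_reindex (e : κ ≃ ι) (v : ι → E) : gd (fun i => v (e i)) = gd v := by
  have : Matrix.gram ℝ (fun i => v (e i)) = (Matrix.gram ℝ v).submatrix e e := rfl
  rw [gd, this, Matrix.det_submatrix_equiv_self, gd]

theorem gd_le_of_mem_span (v w : ι → E) (hv : LinearIndependent ℤ v)
    (h : ∀ i, v i ∈ Submodule.span ℤ (Set.range w)) : gd w ≤ gd v := by
  choose A hA using fun i => (Submodule.mem_span_range_iff_exists_fun ℤ).1 (h i)
  let B : Matrix ι ι ℤ := Matrix.of A
  have hB : B.det ≠ 0 := by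
    intro h0
    obtain ⟨c, hc, hc0⟩ := Matrix.exists_vecMul_eq_zero_iff.2 h0
    apply hc
    have := Fintype.linearIndependent_iff.1 hv c ?_
    · funext i; exact this i
    · simp_rw [← hA, Finset.smul_sum]
      rw [Finset.sum_comm]
      apply Finset.sum_eq_zero
      intro j _
      have h1 := congrFun hc0 j
      simp only [Matrix.vecMul, dotProduct, Pi.zero_apply, B, Matrix.of_apply] at h1
      simp_rw [smul_smul]
      rw [← Finset.sum_smul, h1, zero_smul]
  have hv' : v = fun i => ∑ j, (B.map (Int.cast : ℤ → ℝ)) i j • w j := by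
    funext i
    rw [← hA]
    refine Finset.sum_congr rfl fun j _ => ?_
    simp [B, Int.cast_smul_eq_zsmul]
  have hdet : (B.map (Int.cast : ℤ → ℝ)).det = (B.det : ℝ) := by
    have := (Int.castRingHom ℝ).map_det B
    simpa [RingHom.mapMatrix_apply] using this.symm
  rw [hv', gd_lin, hdet]
  have : (1 : ℝ) ≤ (B.det : ℝ) ^ 2 := by
    have : (1 : ℤ) ≤ B.det ^ 2 := by have := sq_pos_iff.2 hB; omega
    exact_mod_cast this
  nlinarith [gd_nonneg w]

theorem span_coe_basis (N : Submodule ℤ E) (b : Basis ι ℤ N) :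
    Submodule.span ℤ (Set.range fun i => (b i : E)) = N := by
  have := congrArg (Submodule.map N.subtype) b.span_eq
  rw [Submodule.map_span, Submodule.map_top, Submodule.range_subtype, ← Set.range_comp] at this
  exact this

theorem li_coe_basis (N : Submodule ℤ E) (b : Basis ι ℤ N) :
    LinearIndependent ℤ (fun i => (b i : E)) :=
  b.linearIndependent.map' N.subtype (Submodule.ker_subtype N)

theorem covol_eq (N : Submodule ℤ E) (b : Basis ι ℤ N) :
    covol N = √ (gd (fun i => (b i : E))) := by
  have h : ∃ n : ℕ, Nonempty (Basis (Fin n) ℤ N) :=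
    ⟨_, ⟨b.reindex (Fintype.equivFin ι)⟩⟩
  rw [covol, dif_pos h]
  set b0 := h.choose_spec.some
  change √ (gd (fun i => (b0 i : E))) = _
  congr 1
  let e := b0.indexEquiv b
  rw [← gd_reindex e]
  apply le_antisymm
  · apply gd_le_of_mem_span
    · exact (li_coe_basis N b).comp _ e.injective
    · intro i
      rw [span_coe_basis]; exact (b (e i)).2
  · apply gd_le_of_mem_span
    · exact (li_coe_basis N b0)
    · intro i
      have := span_coe_basis N (b.reindex e.symm)
      simp only [Basis.coe_reindex, Function.comp_def, Equiv.symm_symm] at this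
      rw [this]; exact (b0 i).2

end Gram

/-- ℤ-rank. -/
def rk (N : Submodule ℤ E) : ℕ := finrank ℤ N

theorem covol_nonneg (N : Submodule ℤ E) : 0 ≤ covol N := by
  unfold covol
  split_ifs
  · exact Real.sqrt_nonneg _
  · exact le_rfl

instance instTF : Module.IsTorsionFree ℤ E := by
  have : Module ℚ E := Module.compHom E (algebraMap ℚ ℝ)
  have : IsAddTorsionFree E := .of_module_rat _
  infer_instance

theorem tf (N : Submodule ℤ E) [Module.Finite ℤ N] : Module.Free ℤ N := by
  infer_instance

/-- a basis -/
def bas (N : Submodule ℤ E) [Module.Finite ℤ N] : Basis (Fin (rk N)) ℤ N := finBasis ℤ N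

theorem fin_of_le {X Y : Submodule ℤ E} [Module.Finite ℤ Y] (h : X ≤ Y) : Module.Finite ℤ X :=
  Module.Finite.of_injective (Submodule.inclusion h) (Submodule.inclusion_injective h)

theorem covol_le_of_le {X Y : Submodule ℤ E} [Module.Finite ℤ Y] (h : X ≤ Y) (hr : rk X = rk Y) :
    covol Y ≤ covol X := by
  have := fin_of_le h
  rw [covol_eq X ((bas X).reindex (finCongr hr)), covol_eq Y (bas Y)]
  apply Real.sqrt_le_sqrt
  apply gd_le_of_mem_span
  · exact li_coe_basis X _
  · intro i
    rw [span_coe_basis]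
    exact h (Subtype.property _)

theorem covol_of_rk_zero {N : Submodule ℤ E} [Module.Finite ℤ N] (h : rk N = 0) : covol N = 1 := by
  rw [covol_eq N ((bas N).reindex (finCongr h))]
  simp [gd]

theorem rk_eq_zero {N : Submodule ℤ E} [Module.Finite ℤ N] : rk N = 0 ↔ N = ⊥ := by
  exact Submodule.finrank_eq_zero

section Map
variable {E' : Type*} [NormedAddCommGroup E'] [InnerProductSpace ℝ E']

def mapEquiv (N : Submodule ℤ E) (f : E →ₗ[ℤ] E') (h : ∀ x ∈ N, f x = 0 → x = 0) :
    N ≃ₗ[ℤ] N.map f :=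
  LinearEquiv.ofBijective (f.submoduleMap N) ⟨by
    rw [← LinearMap.ker_eq_bot, LinearMap.ker_eq_bot']
    intro x hx
    have := h x x.2 (by simpa using congrArg Subtype.val hx)
    exact Subtype.ext this, f.submoduleMap_surjective N⟩

theorem mapEquiv_coe (N : Submodule ℤ E) (f : E →ₗ[ℤ] E') (h : ∀ x ∈ N, f x = 0 → x = 0) (x : N) :
    ((mapEquiv N f h x : N.map f) : E') = f x := rfl

theorem rk_map (N : Submodule ℤ E) (f : E →ₗ[ℤ] E') (h : ∀ x ∈ N, f x = 0 → x = 0) :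
    rk (N.map f) = rk N := (mapEquiv N f h).finrank_eq.symm

theorem covol_map_iso (N : Submodule ℤ E) [Module.Finite ℤ N] (f : E →ₗ[ℤ] E')
    (h : ∀ x ∈ N, ∀ y ∈ N, inner ℝ (f x) (f y) = inner ℝ x y) :
    rk (N.map f) = rk N ∧ covol (N.map f) = covol N := by
  have h0 : ∀ x ∈ N, f x = 0 → x = 0 := by
    intro x hx h0
    have := h x hx x hx
    rw [h0, inner_zero_left] at this
    exact inner_self_eq_zero.1 this.symm
  refine ⟨rk_map N f h0, ?_⟩
  rw [covol_eq _ ((bas N).map (mapEquiv N f h0)), covol_eq N (bas N)]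
  congr 1
  unfold gd
  congr 1
  ext i j
  simp only [Matrix.gram_apply, Basis.map_apply, mapEquiv_coe]
  exact h _ (Subtype.property _) _ (Subtype.property _)

end Map

theorem det_one_add {ι : Type*} [Fintype ι] [DecidableEq ι] {X : Matrix ι ι ℝ}
    (hX : X.PosSemidef) : 1 ≤ (1 + X).det := by
  have hY : (1 + X).IsHermitian := Matrix.isHermitian_one.add hX.1
  rw [hY.det_eq_prod_eigenvalues]
  simp only [RCLike.ofReal_real_eq_id, id]
  have : ∀ i, 1 ≤ hY.eigenvalues i := by
    intro i
    rw [hY.eigenvalues_eq]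
    have h1 := hX.dotProduct_mulVec_nonneg (hY.eigenvectorBasis i).ofLp
    have h2 : (star (hY.eigenvectorBasis i).ofLp ⬝ᵥ (hY.eigenvectorBasis i).ofLp) = 1 := by
      have := (hY.eigenvectorBasis).orthonormal.1 i
      have h3 := real_inner_self_eq_norm_sq (hY.eigenvectorBasis i)
      rw [this, EuclideanSpace.inner_eq_star_dotProduct] at h3
      rw [dotProduct_comm]
      simpa using h3
    rw [Matrix.add_mulVec, Matrix.one_mulVec, dotProduct_add, h2]
    simpa using h1
  exact Finset.one_le_prod fun i _ => this i

theorem det_le_of_sub {ι : Type*} [Fintype ι] [DecidableEq ι] {A B : Matrix ι ι ℝ}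
    (hA : A.PosSemidef) (hAB : (B - A).PosSemidef) : A.det ≤ B.det := by
  have hB : B.PosSemidef := by simpa using hAB.add hA
  by_cases h0 : A.det = 0
  · rw [h0]; exact hB.det_nonneg
  obtain ⟨C, hC⟩ : ∃ C : Matrix ι ι ℝ, A = C.conjTranspose * C := by
    open scoped MatrixOrder in
    exact CStarAlgebra.nonneg_iff_eq_star_mul_self.mp hA.nonneg
  have hCd : A.det = C.det ^ 2 := by
    rw [hC, Matrix.det_mul, Matrix.det_conjTranspose]; simp; ring
  have hCu : IsUnit C.det := by
    rw [isUnit_iff_ne_zero]; intro h; rw [hCd, h] at h0; simp at h0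
  have hX := hAB.conjTranspose_mul_mul_same C⁻¹
  have hBX : B = C.conjTranspose * (1 + (C⁻¹).conjTranspose * (B - A) * C⁻¹) * C := by
    have e1 : C.conjTranspose * (C⁻¹).conjTranspose = 1 := by
      rw [← Matrix.conjTranspose_mul, Matrix.nonsing_inv_mul C hCu, Matrix.conjTranspose_one]
    have e2 : C⁻¹ * C = 1 := Matrix.nonsing_inv_mul C hCu
    rw [Matrix.mul_add, Matrix.add_mul, Matrix.mul_one, ← hC]
    have : C.conjTranspose * ((C⁻¹).conjTranspose * (B - A) * C⁻¹) * C
      = (C.conjTranspose * (C⁻¹).conjTranspose) * (B - A) * (C⁻¹ * C) := by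
      simp only [Matrix.mul_assoc]
    rw [this, e1, e2]; simp
  have := det_one_add hX
  rw [hBX, Matrix.det_mul, Matrix.det_mul, Matrix.det_conjTranspose, hCd]
  simp only [star_trivial]
  nlinarith [sq_nonneg C.det]

theorem gd_contr {E' : Type*} [NormedAddCommGroup E'] [InnerProductSpace ℝ E']
    {ι : Type*} [Fintype ι] [DecidableEq ι] (f : E →ₗ[ℝ] E') (hf : ∀ x, ‖f x‖ ≤ ‖x‖)
    (v : ι → E) : gd (fun i => f (v i)) ≤ gd v := by
  apply det_le_of_sub (Matrix.posSemidef_gram ℝ _)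
  refine .of_dotProduct_mulVec_nonneg
    ((Matrix.isHermitian_gram ℝ v).sub (Matrix.isHermitian_gram ℝ _)) fun x ↦ ?_
  rw [Matrix.sub_mulVec, dotProduct_sub, Matrix.star_dotProduct_gram_mulVec,
    Matrix.star_dotProduct_gram_mulVec]
  simp_rw [← map_smul, ← map_sum]
  rw [real_inner_self_eq_norm_sq, real_inner_self_eq_norm_sq, sub_nonneg]
  gcongr
  exact hf _

theorem covol_contr {E' : Type*} [NormedAddCommGroup E'] [InnerProductSpace ℝ E']
    (N : Submodule ℤ E) [Module.Finite ℤ N] (f : E →ₗ[ℝ] E') (hf : ∀ x, ‖f x‖ ≤ ‖x‖)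
    (h0 : ∀ x ∈ N, f x = 0 → x = 0) :
    covol (N.map (f.restrictScalars ℤ)) ≤ covol N := by
  rw [covol_eq _ ((bas N).map (mapEquiv N (f.restrictScalars ℤ) h0)), covol_eq N (bas N)]
  exact Real.sqrt_le_sqrt (gd_contr f hf _)



section Ext
variable {E' : Type*} [NormedAddCommGroup E'] [InnerProductSpace ℝ E']

instance finMap (N : Submodule ℤ E) [Module.Finite ℤ N] (f : E →ₗ[ℤ] E') :
    Module.Finite ℤ (N.map f) := Module.Finite.map N f

instance finInf (N K : Submodule ℤ E) [Module.Finite ℤ N] :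
    Module.Finite ℤ (N ⊓ K : Submodule ℤ E) := fin_of_le inf_le_left

theorem exists_basis (N : Submodule ℤ E) [Module.Finite ℤ N] (f : E →ₗ[ℤ] E') :
    ∃ b : Basis (Fin (rk (N ⊓ LinearMap.ker f)) ⊕ Fin (rk (N.map f))) ℤ N,
      (∀ i, (b (Sum.inl i) : E) = bas (N ⊓ LinearMap.ker f) i) ∧
      ∀ j, f (b (Sum.inr j)) = bas (N.map f) j := by
  let g := f.submoduleMap N
  have hg : Function.Surjective g := f.submoduleMap_surjective N
  let W := LinearMap.ker g
  have hW : W.map N.subtype = N ⊓ LinearMap.ker f := by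
    ext x
    simp only [Submodule.mem_map, Submodule.mem_inf, LinearMap.mem_ker, W]
    constructor
    · rintro ⟨y, hy, rfl⟩
      exact ⟨y.2, by simpa [g] using congrArg Subtype.val hy⟩
    · rintro ⟨h1, h2⟩
      exact ⟨⟨x, h1⟩, Subtype.ext h2, rfl⟩
  let e : W ≃ₗ[ℤ] (N ⊓ LinearMap.ker f : Submodule ℤ E) :=
    (Submodule.equivSubtypeMap N W).trans (LinearEquiv.ofEq _ _ hW)
  let bW := (bas (N ⊓ LinearMap.ker f)).map e.symm
  let q : (N ⧸ W) ≃ₗ[ℤ] N.map f := g.quotKerEquivOfSurjective hg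
  let bQ := (bas (N.map f)).map q.symm
  refine ⟨Basis.sumQuot bW bQ, ?_, ?_⟩
  · intro i
    rw [Basis.sumQuot_inl]
    have : ∀ w : W, ((e w : (N ⊓ LinearMap.ker f : Submodule ℤ E)) : E) = ((w : N) : E) := fun w => rfl
    rw [← this]
    simp [bW]
  · intro j
    have h := Basis.sumQuot_inr bW bQ j
    have h2 := congrArg q h
    have h3 : q (bQ j) = bas (N.map f) j := by simp [bQ]
    rw [h3] at h2
    rw [← h2]
    rfl

theorem rk_add (N : Submodule ℤ E) [Module.Finite ℤ N] (f : E →ₗ[ℤ] E') :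
    rk N = rk (N ⊓ LinearMap.ker f) + rk (N.map f) := by
  obtain ⟨b, -, -⟩ := exists_basis N f
  have := finrank_eq_card_basis b
  rw [Fintype.card_sum, Fintype.card_fin, Fintype.card_fin] at this
  exact this

end Ext

/-- Orthogonal projection killing `K`. -/
def pr [FiniteDimensional ℝ E] (K : Submodule ℝ E) : E →ₗ[ℝ] E := (Kᗮ.starProjection : E →L[ℝ] E)

/-- ℤ-structure on K -/
abbrev rz (K : Submodule ℝ E) : Submodule ℤ E := K.restrictScalars ℤ

/-- pr over ℤ -/
abbrev prz [FiniteDimensional ℝ E] (K : Submodule ℝ E) : E →ₗ[ℤ] E := (pr K).restrictScalars ℤ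

section
variable [FiniteDimensional ℝ E] (K : Submodule ℝ E)

theorem pr_mem (x : E) : pr K x ∈ Kᗮ := Submodule.starProjection_apply_mem _ _

theorem sub_pr_mem (x : E) : x - pr K x ∈ K := by
  have := Submodule.sub_starProjection_mem_orthogonal (K := Kᗮ) x
  rwa [Submodule.orthogonal_orthogonal] at this

theorem pr_eq {x y : E} (hy : y ∈ Kᗮ) (hxy : x - y ∈ K) : pr K x = y := by
  apply Submodule.eq_starProjection_of_mem_of_inner_eq_zero hy
  intro w hw
  exact hw _ hxy

theorem pr_eq_zero {x : E} : pr K x = 0 ↔ x ∈ K := by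
  constructor
  · intro h
    have := sub_pr_mem K x
    rwa [h, sub_zero] at this
  · intro h
    exact pr_eq K (Submodule.zero_mem _) (by simpa using h)

theorem norm_pr_le (x : E) : ‖pr K x‖ ≤ ‖x‖ := Submodule.norm_starProjection_apply_le _ x

theorem ker_prz : LinearMap.ker (prz K) = rz K := by
  ext x
  simp [pr_eq_zero]

theorem gd_block {ι κ : Type*} [Fintype ι] [DecidableEq ι] [Fintype κ] [DecidableEq κ]
    (k : ι → E) (w u : κ → E) (h : ∀ i j, inner ℝ (k i) (w j) = 0)
    (hu : ∀ j, u j - w j ∈ Submodule.span ℝ (Set.range k)) :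
    gd (Sum.elim k u) = gd k * gd w := by
  choose C hC using fun j => (Submodule.mem_span_range_iff_exists_fun ℝ).1 (hu j)
  have hb : Sum.elim k u =
      fun i => ∑ j, (Matrix.fromBlocks 1 0 (Matrix.of C) 1 : Matrix _ _ ℝ) i j • Sum.elim k w j := by
    funext i
    rw [Fintype.sum_sum_type]
    rcases i with i | j
    · simp [Matrix.one_apply]
    · simp [Matrix.one_apply, hC]
  have hG : Matrix.gram ℝ (Sum.elim k w) =
      Matrix.fromBlocks (Matrix.gram ℝ k) 0 0 (Matrix.gram ℝ w) := by
    ext i j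
    rcases i with i | i <;> rcases j with j | j
    · rfl
    · exact h i j
    · simp only [Matrix.gram_apply, Sum.elim_inl, Sum.elim_inr, Matrix.fromBlocks_apply₂₁]
      rw [real_inner_comm]
      exact h j i
    · rfl
  rw [hb, gd_lin, Matrix.det_fromBlocks_zero₁₂, gd, hG, Matrix.det_fromBlocks_zero₁₂]
  simp [gd]

theorem covol_ext (N : Submodule ℤ E) [Module.Finite ℤ N]
    (hK : K ≤ Submodule.span ℝ ((N ⊓ rz K : Submodule ℤ E) : Set E)) :
    covol N = covol (N ⊓ rz K) * covol (N.map (prz K)) := by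
  obtain ⟨b, hb1, hb2⟩ := exists_basis N (prz K)
  rw [← ker_prz] at hK ⊢
  rw [covol_eq N b, covol_eq _ (bas (N ⊓ LinearMap.ker (prz K))),
    covol_eq _ (bas (N.map (prz K))), ← Real.sqrt_mul (gd_nonneg _)]
  rw [← gd_block _ _ (fun j => (b (Sum.inr j) : E))]
  · congr 2
    funext i
    rcases i with i | i
    · exact hb1 i
    · rfl
  · intro i j
    have h1 : ((bas (N ⊓ LinearMap.ker (prz K)) i : _) : E) ∈ K := by
      rw [← pr_eq_zero]
      exact (bas (N ⊓ LinearMap.ker (prz K)) i).2.2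
    rw [← hb2]
    exact pr_mem K _ _ h1
  · intro j
    rw [← Submodule.span_span_of_tower ℤ, span_coe_basis, ← hb2]
    exact hK (sub_pr_mem K _)

theorem covol_ext_le {E' : Type*} [NormedAddCommGroup E'] [InnerProductSpace ℝ E']
    (N : Submodule ℤ E) [Module.Finite ℤ N] (f : E →ₗ[ℝ] E') (hf : ∀ x, ‖f x‖ ≤ ‖x‖) :
    covol (N ⊓ LinearMap.ker (f.restrictScalars ℤ)) * covol (N.map (f.restrictScalars ℤ))
      ≤ covol N := by
  set Z := N ⊓ LinearMap.ker (f.restrictScalars ℤ) with hZ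
  let K : Submodule ℝ E := Submodule.span ℝ (Z : Set E)
  have hKf : K ≤ LinearMap.ker f := by
    rw [Submodule.span_le]
    intro x hx
    exact hx.2
  have hNK : N ⊓ rz K = Z := by
    apply le_antisymm
    · intro x hx
      exact ⟨hx.1, hKf hx.2⟩
    · intro x hx
      exact ⟨hx.1, Submodule.subset_span hx⟩
  have h1 := covol_ext K N (by rw [hNK])
  rw [h1, hNK]
  apply mul_le_mul_of_nonneg_left _ (covol_nonneg _)
  have hfp : ∀ x, f (pr K x) = f x := by
    intro x
    have := hKf (sub_pr_mem K x)
    rw [LinearMap.mem_ker, map_sub, sub_eq_zero] at this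
    exact this.symm
  have h2 : N.map (f.restrictScalars ℤ) = (N.map (prz K)).map (f.restrictScalars ℤ) := by
    rw [← Submodule.map_comp]
    congr 1
    ext x
    simp [hfp]
  rw [h2]
  apply covol_contr _ f hf
  rintro _ ⟨x, hx, rfl⟩ h0
  simp only [LinearMap.coe_restrictScalars] at h0 ⊢
  rw [hfp] at h0
  rw [pr_eq_zero]
  exact Submodule.subset_span ⟨hx, h0⟩

end

/-- All sublattices have slope at least `a`. -/
def AA (N : Submodule ℤ E) (a : ℝ) : Prop := ∀ X ≤ N, a ^ rk X ≤ covol X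

theorem AA.mono {N N' : Submodule ℤ E} {a : ℝ} (h : AA N a) (hN : N' ≤ N) : AA N' a :=
  fun X hX => h X (hX.trans hN)

theorem AA.mono' {N : Submodule ℤ E} {a a' : ℝ} (h : AA N a) (h0 : 0 ≤ a') (ha : a' ≤ a) :
    AA N a' :=
  fun X hX => (pow_le_pow_left₀ h0 ha _).trans (h X hX)

theorem AA.of_iso {E' : Type*} [NormedAddCommGroup E'] [InnerProductSpace ℝ E']
    {N : Submodule ℤ E} [Module.Finite ℤ N] {a : ℝ} (f : E →ₗ[ℤ] E')
    (hf : ∀ x ∈ N, ∀ y ∈ N, inner ℝ (f x) (f y) = inner ℝ x y) (h : AA (N.map f) a) : AA N a := by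
  intro X hX
  have := fin_of_le hX
  obtain ⟨h1, h2⟩ := covol_map_iso X f (fun x hx y hy => hf x (hX hx) y (hX hy))
  rw [← h1, ← h2]
  exact h _ (Submodule.map_mono hX)

theorem AA.ext {E' : Type*} [NormedAddCommGroup E'] [InnerProductSpace ℝ E']
    [FiniteDimensional ℝ E]
    {N : Submodule ℤ E} [Module.Finite ℤ N] {a : ℝ} (ha : 0 ≤ a)
    (f : E →ₗ[ℝ] E') (hf : ∀ x, ‖f x‖ ≤ ‖x‖)
    (h1 : AA (N ⊓ LinearMap.ker (f.restrictScalars ℤ)) a)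
    (h2 : AA (N.map (f.restrictScalars ℤ)) a) : AA N a := by
  intro X hX
  have := fin_of_le hX
  rw [rk_add X (f.restrictScalars ℤ), pow_add]
  refine le_trans ?_ (covol_ext_le X f hf)
  apply mul_le_mul (h1 _ (inf_le_inf_right _ hX)) (h2 _ (Submodule.map_mono hX)) (by positivity)
    (covol_nonneg _)



/-- real span -/
abbrev sp (N : Submodule ℤ E) : Submodule ℝ E := Submodule.span ℝ (N : Set E)

/-- A (not necessarily full) lattice. -/
def IsLt (N : Submodule ℤ E) : Prop := Module.Finite ℤ N ∧ finrank ℝ (sp N) = rk N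

theorem sp_basis {ι : Type*} [Fintype ι] (N : Submodule ℤ E) (b : Basis ι ℤ N) :
    Submodule.span ℝ (Set.range fun i => (b i : E)) = sp N := by
  classical
  conv_rhs => rw [sp, ← span_coe_basis N b]
  rw [Submodule.span_span_of_tower]

theorem finrank_sp_le (N : Submodule ℤ E) [Module.Finite ℤ N] : finrank ℝ (sp N) ≤ rk N := by
  rw [← sp_basis N (bas N)]
  exact (finrank_range_le_card _).trans (by simp)

theorem IsLt.li {ι : Type*} [Fintype ι] {N : Submodule ℤ E} (h : IsLt N) (b : Basis ι ℤ N) :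
    LinearIndependent ℝ (fun i => (b i : E)) := by
  rw [linearIndependent_iff_card_eq_finrank_span, Set.finrank, sp_basis N b, h.2, rk,
    finrank_eq_card_basis b]

theorem IsLt.covol_pos {N : Submodule ℤ E} (h : IsLt N) : 0 < covol N := by
  have := h.1
  rw [covol_eq N (bas N)]
  exact Real.sqrt_pos.2 ((gd_pos_iff _).2 (h.li _))

theorem exists_basis_of_li {ι : Type*} [Fintype ι] [DecidableEq ι] (v : ι → E)
    (hv : LinearIndependent ℝ v) (N : Submodule ℤ E) (hN : N = Submodule.span ℤ (Set.range v)) :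
    ∃ b : Basis ι ℤ N, ∀ i, (b i : E) = v i := by
  subst hN
  have hz : LinearIndependent ℤ v := hv.restrict_scalars (by
    intro a b h
    simpa using h)
  exact ⟨Basis.span hz, fun i => by rw [Basis.span_apply]⟩

theorem isLt_of_li {ι : Type*} [Fintype ι] [DecidableEq ι] (v : ι → E)
    (hv : LinearIndependent ℝ v) (N : Submodule ℤ E) (hN : N = Submodule.span ℤ (Set.range v)) :
    IsLt N ∧ rk N = Fintype.card ι ∧ covol N = √ (gd v) := by
  obtain ⟨b, hb⟩ := exists_basis_of_li v hv N hN
  have hr : rk N = Fintype.card ι := finrank_eq_card_basis b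
  refine ⟨⟨Module.Finite.of_basis b, ?_⟩, hr, ?_⟩
  · rw [hr, ← sp_basis N b, show (fun i => (b i : E)) = v from funext hb]
    exact finrank_span_eq_card hv
  · rw [covol_eq N b, show (fun i => (b i : E)) = v from funext hb]

section
variable [FiniteDimensional ℝ E]

theorem sp_le_sup (N : Submodule ℤ E) (K : Submodule ℝ E) : sp N ≤ K ⊔ sp (N.map (prz K)) := by
  rw [Submodule.span_le]
  intro x hx
  have : x = (x - pr K x) + pr K x := by abel
  rw [this]
  exact Submodule.add_mem_sup (sub_pr_mem K x) (Submodule.subset_span ⟨x, hx, rfl⟩)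

theorem finrank_sp_le_add (N : Submodule ℤ E) (K : Submodule ℝ E) :
    finrank ℝ (sp N) ≤ finrank ℝ K + finrank ℝ (sp (N.map (prz K))) :=
  (Submodule.finrank_mono (sp_le_sup N K)).trans (Submodule.finrank_add_le_finrank_add_finrank _ _)

theorem rk_add' (N : Submodule ℤ E) [Module.Finite ℤ N] (K : Submodule ℝ E) :
    rk N = rk (N ⊓ rz K) + rk (N.map (prz K)) := by
  have := rk_add N (prz K)
  rwa [ker_prz] at this

theorem rk_mono {X Y : Submodule ℤ E} [Module.Finite ℤ Y] (h : X ≤ Y) : rk X ≤ rk Y := by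
  exact LinearMap.finrank_le_finrank_of_injective (Submodule.inclusion_injective h)

theorem IsLt.sub_aux {N X : Submodule ℤ E} (h : IsLt N) (hX : X ≤ N) :
    finrank ℝ (sp X) = rk X ∧ rk (N ⊓ rz (sp X)) = rk X := by
  have := h.1
  have := fin_of_le hX
  have h1 := finrank_sp_le_add N (sp X)
  have h2 := rk_add' N (sp X)
  have h3 := finrank_sp_le X
  have h4 := finrank_sp_le (N.map (prz (sp X)))
  have h5 : rk X ≤ rk (N ⊓ rz (sp X)) :=
    rk_mono (le_inf hX (fun x hx => Submodule.subset_span hx))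
  have h6 := h.2
  omega

theorem IsLt.sub {N X : Submodule ℤ E} (h : IsLt N) (hX : X ≤ N) : IsLt X := by
  have := h.1
  exact ⟨fin_of_le hX, (h.sub_aux hX).1⟩

theorem IsLt.quot {N : Submodule ℤ E} (h : IsLt N) (K : Submodule ℝ E) (hK : K ≤ sp (N ⊓ rz K)) :
    IsLt (N.map (prz K)) := by
  have := h.1
  refine ⟨inferInstance, le_antisymm (finrank_sp_le _) ?_⟩
  have h1 := finrank_sp_le_add N K
  have h2 := rk_add' N K
  have h3 := finrank_sp_le (N ⊓ rz K)
  have h4 := Submodule.finrank_mono hK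
  have h5 := h.2
  omega

end

section Tensor
variable {F G : Type*} [NormedAddCommGroup F] [InnerProductSpace ℝ F]
    [NormedAddCommGroup G] [InnerProductSpace ℝ G] {t : E →ₗ[ℝ] F →ₗ[ℝ] G}

theorem gd_tensor (ht : IsTensor t) {ι κ : Type*} [Fintype ι] [DecidableEq ι] [Fintype κ]
    [DecidableEq κ] (v : ι → E) (w : κ → F) :
    gd (fun p : ι × κ => t (v p.1) (w p.2)) = gd v ^ Fintype.card κ * gd w ^ Fintype.card ι := by
  have : Matrix.gram ℝ (fun p : ι × κ => t (v p.1) (w p.2)) =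
      Matrix.kroneckerMap (· * ·) (Matrix.gram ℝ v) (Matrix.gram ℝ w) := by
    ext p q
    simp [Matrix.gram_apply, ht.2]
  rw [gd, this, Matrix.det_kronecker, gd, gd]

theorem t_li (ht : IsTensor t) {ι κ : Type*} [Fintype ι] [DecidableEq ι] [Fintype κ]
    [DecidableEq κ] {v : ι → E} {w : κ → F} (hv : LinearIndependent ℝ v)
    (hw : LinearIndependent ℝ w) :
    LinearIndependent ℝ (fun p : ι × κ => t (v p.1) (w p.2)) := by
  rw [← gd_pos_iff, gd_tensor ht]
  have := (gd_pos_iff v).2 hv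
  have := (gd_pos_iff w).2 hw
  positivity

theorem mem_tensorLat {N : Submodule ℤ E} {M : Submodule ℤ F} {x : E} {y : F} (hx : x ∈ N)
    (hy : y ∈ M) : t x y ∈ tensorLat t N M := Submodule.subset_span ⟨x, hx, y, hy, rfl⟩

theorem tensorLat_mono {N N' : Submodule ℤ E} {M M' : Submodule ℤ F} (h : N ≤ N') (h' : M ≤ M') :
    tensorLat t N M ≤ tensorLat t N' M' := by
  apply Submodule.span_mono
  rintro _ ⟨x, hx, y, hy, rfl⟩
  exact ⟨x, h hx, y, h' hy, rfl⟩

theorem tensorLat_exists (N : Submodule ℤ E) (M : Submodule ℤ F) {κ : Type*} [Fintype κ]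
    (c : Basis κ ℤ M) {x : G} (hx : x ∈ tensorLat t N M) :
    ∃ l : κ → E, (∀ j, l j ∈ N) ∧ x = ∑ j, t (l j) (c j) := by
  induction hx using Submodule.span_induction with
  | mem x hx =>
    obtain ⟨x, hx, y, hy, rfl⟩ := hx
    refine ⟨fun j => c.repr ⟨y, hy⟩ j • x, fun j => N.smul_mem _ hx, ?_⟩
    have : y = ∑ j, c.repr ⟨y, hy⟩ j • (c j : F) := by
      have := congrArg Subtype.val (c.sum_repr ⟨y, hy⟩)
      rw [AddSubmonoidClass.coe_finsetSum] at this
      exact this.symm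
    dsimp only
    conv_lhs => rw [this]
    rw [map_sum]
    refine Finset.sum_congr rfl fun j _ => ?_
    rw [map_zsmul, map_zsmul, LinearMap.smul_apply]
  | zero => exact ⟨0, fun j => N.zero_mem, by simp⟩
  | add x y _ _ hx hy =>
    obtain ⟨l, hl, rfl⟩ := hx
    obtain ⟨l', hl', rfl⟩ := hy
    exact ⟨l + l', fun j => N.add_mem (hl j) (hl' j), by simp [Finset.sum_add_distrib]⟩
  | smul a x _ hx =>
    obtain ⟨l, hl, rfl⟩ := hx
    refine ⟨a • l, fun j => N.smul_mem a (hl j), ?_⟩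
    rw [Finset.smul_sum]
    refine Finset.sum_congr rfl fun j _ => ?_
    rw [Pi.smul_apply, map_zsmul, LinearMap.smul_apply]

theorem tensorLat_span (N : Submodule ℤ E) (M : Submodule ℤ F) {ι κ : Type*} [Fintype κ] [Fintype ι]
    (b : Basis ι ℤ N) (c : Basis κ ℤ M) :
    tensorLat t N M = Submodule.span ℤ (Set.range fun p : ι × κ => t (b p.1) (c p.2)) := by
  apply le_antisymm
  · intro x hx
    obtain ⟨l, hl, rfl⟩ := tensorLat_exists N M c hx
    refine Submodule.sum_mem _ fun j _ => ?_
    have : l j = ∑ i, b.repr ⟨l j, hl j⟩ i • (b i : E) := by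
      have := congrArg Subtype.val (b.sum_repr ⟨l j, hl j⟩)
      rw [AddSubmonoidClass.coe_finsetSum] at this
      exact this.symm
    rw [this, map_sum, LinearMap.sum_apply]
    refine Submodule.sum_mem _ fun i _ => ?_
    rw [map_zsmul, LinearMap.smul_apply]
    exact Submodule.smul_mem _ _ (Submodule.subset_span ⟨(i, j), rfl⟩)
  · rw [Submodule.span_le]
    rintro _ ⟨p, rfl⟩
    exact mem_tensorLat (b p.1).2 (c p.2).2

theorem sqrt_pow' {x : ℝ} (hx : 0 ≤ x) (k : ℕ) : √ (x ^ k) = √ x ^ k := by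
  rw [Real.sqrt_eq_iff_mul_self_eq (pow_nonneg hx k) (pow_nonneg (Real.sqrt_nonneg _) k),
    ← mul_pow, Real.mul_self_sqrt hx]

theorem tensor_info (ht : IsTensor t) {N : Submodule ℤ E} {M : Submodule ℤ F} (hN : IsLt N)
    (hM : IsLt M) : IsLt (tensorLat t N M) ∧ rk (tensorLat t N M) = rk N * rk M ∧
      covol (tensorLat t N M) = covol N ^ rk M * covol M ^ rk N := by
  have := hN.1
  have := hM.1
  obtain ⟨h1, h2, h3⟩ := isLt_of_li _ (t_li ht (hN.li (bas N)) (hM.li (bas M))) _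
    (tensorLat_span (t := t) N M (bas N) (bas M))
  refine ⟨h1, by simpa using h2, ?_⟩
  rw [h3, gd_tensor ht (fun i => (bas N i : E)) (fun i => (bas M i : F)), covol_eq N (bas N),
    covol_eq M (bas M)]
  rw [Real.sqrt_mul (pow_nonneg (gd_nonneg _) _), sqrt_pow' (gd_nonneg _), sqrt_pow' (gd_nonneg _), Fintype.card_fin,
    Fintype.card_fin]

theorem fd_tensor [FiniteDimensional ℝ E] [FiniteDimensional ℝ F] (ht : IsTensor t) :
    FiniteDimensional ℝ G :=
  Module.Finite.of_surjective _ ht.1.2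

/-- The tensor step of the dévissage. -/
theorem AA_tensor_ext [FiniteDimensional ℝ E] [FiniteDimensional ℝ F] (ht : IsTensor t)
    {N : Submodule ℤ E} {M : Submodule ℤ F} (hN : IsLt N) (hM : IsLt M) (K : Submodule ℝ E)
    {a : ℝ} (ha : 0 ≤ a) (h1 : AA (tensorLat t (N ⊓ rz K) M) a)
    (h2 : AA (tensorLat t (N.map (prz K)) M) a) : AA (tensorLat t N M) a := by
  have := fd_tensor ht
  have := hN.1
  have := hM.1
  have := (tensor_info ht hN hM).1.1
  let W : Submodule ℝ G := Submodule.span ℝ (Set.image2 (fun x y => t x y) (K : Set E) Set.univ)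
  have hP : ∀ x y, pr W (t x y) = t (pr K x) y := by
    intro x y
    apply pr_eq
    · rw [Submodule.mem_orthogonal]
      intro u hu
      induction hu using Submodule.span_induction with
      | mem u hu =>
        obtain ⟨x', hx', y', -, rfl⟩ := hu
        rw [ht.2, pr_mem K x x' hx', zero_mul]
      | zero => simp
      | add u v _ _ hu hv => rw [inner_add_left, hu, hv, add_zero]
      | smul a u _ hu => rw [real_inner_smul_left, hu, mul_zero]
    · rw [← LinearMap.sub_apply, ← map_sub]
      exact Submodule.subset_span ⟨_, sub_pr_mem K x, y, trivial, rfl⟩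
  apply AA.ext ha (pr W) (norm_pr_le W)
  · apply h1.mono
    rintro x ⟨hx, hx0⟩
    obtain ⟨l, hl, rfl⟩ := tensorLat_exists N M (bas M) hx
    refine Submodule.sum_mem _ fun j _ => mem_tensorLat ⟨hl j, ?_⟩ (bas M j).2
    have h0 : ∑ j, t (pr K (l j)) (bas M j) = 0 := by
      have : pr W (∑ j, t (l j) (bas M j)) = 0 := hx0
      rw [map_sum] at this
      simpa [hP] using this
    change l j ∈ K
    rw [← pr_eq_zero]
    let o := stdOrthonormalBasis ℝ E
    have hli := t_li ht o.toBasis.linearIndependent (hM.li (bas M))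
    rw [Fintype.linearIndependent_iff] at hli
    have := hli (fun p => o.toBasis.repr (pr K (l p.2)) p.1) ?_
    · apply o.toBasis.ext_elem
      intro i
      simpa using this (i, j)
    · rw [← h0, Fintype.sum_prod_type_right]
      refine Finset.sum_congr rfl fun j _ => ?_
      conv_rhs => rw [← o.toBasis.sum_repr (pr K (l j))]
      simp only [map_sum, LinearMap.sum_apply, map_smul, LinearMap.smul_apply]
  · apply h2.mono
    rintro _ ⟨x, hx, rfl⟩
    induction hx using Submodule.span_induction with
    | mem u hu =>
      obtain ⟨x', hx', y', hy', rfl⟩ := hu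
      simp only [LinearMap.coe_restrictScalars, hP]
      exact mem_tensorLat ⟨x', hx', rfl⟩ hy'
    | zero => simp
    | add u v _ _ hu hv => rw [map_add]; exact Submodule.add_mem _ hu hv
    | smul a u _ hu => rw [map_smul]; exact Submodule.smul_mem _ _ hu

end Tensor


theorem AA_zero {N : Submodule ℤ E} (hN : IsLt N) : AA N 0 := by
  intro X hX
  have := hN.1
  have := fin_of_le hX
  by_cases h : rk X = 0
  · rw [covol_of_rk_zero h, h, pow_zero]
  · rw [zero_pow h]
    exact covol_nonneg X

/-- The best constant for `AA` is attained. -/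
theorem exists_best {N : Submodule ℤ E} (hN : IsLt N) (h0 : rk N ≠ 0) :
    ∃ h, 0 ≤ h ∧ AA N h ∧ ∀ a, 0 ≤ a → AA N a → a ≤ h := by
  let S : Set ℝ := {a | 0 ≤ a ∧ AA N a}
  have hne : S.Nonempty := ⟨0, le_rfl, AA_zero hN⟩
  have hbd : BddAbove S := by
    refine ⟨max 1 (covol N), ?_⟩
    rintro a ⟨ha, h⟩
    rcases le_total a 1 with h1 | h1
    · exact h1.trans (le_max_left _ _)
    · exact ((le_self_pow₀ h1 h0).trans (h N le_rfl)).trans (le_max_right _ _)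
  have hcl : IsClosed S := by
    have : S = Set.Ici 0 ∩ ⋂ X : Submodule ℤ E, ⋂ _ : X ≤ N, {a : ℝ | a ^ rk X ≤ covol X} := by
      ext a
      simp [S, AA]
    rw [this]
    refine isClosed_Ici.inter (isClosed_iInter fun X => isClosed_iInter fun _ => ?_)
    exact isClosed_le (continuous_pow _) continuous_const
  have := hcl.csSup_mem hne hbd
  exact ⟨sSup S, this.1, this.2, fun a ha h => le_csSup hbd ⟨ha, h⟩⟩

section
variable [FiniteDimensional ℝ E]

theorem AA_quot {N X : Submodule ℤ E} (hN : IsLt N) (hX : X ≤ N) {h h' : ℝ} (h0 : 0 < h)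
    (hh : h < h') (hA : AA N h) (hc : covol X < h' ^ rk X) :
    AA (N.map (prz (sp X))) (h * (h / h') ^ rk N) := by
  have := hN.1
  have hr := (hN.sub_aux hX).2
  set K := sp X with hK
  have hXK : X ≤ N ⊓ rz K := le_inf hX (fun x hx => Submodule.subset_span hx)
  have hcK : covol (N ⊓ rz K) ≤ covol X := covol_le_of_le hXK hr.symm
  have h0' : 0 < h' := h0.trans hh
  intro Z hZ
  have := fin_of_le hZ
  by_cases hz : rk Z = 0
  · rw [covol_of_rk_zero hz, hz, pow_zero]
  let Y : Submodule ℤ E := N ⊓ Z.comap (prz K)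
  have hY1 : Y ⊓ rz K = N ⊓ rz K := by
    apply le_antisymm
    · exact inf_le_inf_right _ inf_le_left
    · rintro x ⟨hx, hxK⟩
      refine ⟨⟨hx, ?_⟩, hxK⟩
      have : prz K x = 0 := (pr_eq_zero K).2 hxK
      change prz K x ∈ Z
      rw [this]
      exact Z.zero_mem
  have hY2 : Y.map (prz K) = Z := by
    apply le_antisymm
    · rintro _ ⟨x, ⟨-, hx⟩, rfl⟩
      exact hx
    · intro z hz
      obtain ⟨x, hx, rfl⟩ := hZ hz
      exact ⟨x, ⟨hx, hz⟩, rfl⟩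
  have e1 := rk_add' Y K
  have e2 := covol_ext K Y (by
    rw [hY1]
    exact Submodule.span_mono hXK)
  rw [hY1, hY2] at e1 e2
  have e3 := hA Y inf_le_left
  rw [e1, e2, hr] at e3
  have hzc := covol_nonneg Z
  have e4 : h ^ (rk X + rk Z) ≤ h' ^ rk X * covol Z :=
    e3.trans (mul_le_mul_of_nonneg_right (hcK.trans hc.le) hzc)
  have e5 : h ^ rk Z * (h / h') ^ rk X ≤ covol Z := by
    rw [div_pow, mul_div_assoc', div_le_iff₀ (by positivity), ← pow_add, add_comm, mul_comm (covol Z)]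
    exact e4
  refine le_trans ?_ e5
  rw [mul_pow, ← pow_mul]
  refine mul_le_mul_of_nonneg_left ?_ (by positivity)
  apply pow_le_pow_of_le_one (by positivity) ((div_le_one h0').2 hh.le)
  have : rk X ≤ rk N := rk_mono hX
  exact this.trans (Nat.le_mul_of_pos_right _ (Nat.pos_of_ne_zero hz))

variable {F G : Type*} [NormedAddCommGroup F] [InnerProductSpace ℝ F]
    [NormedAddCommGroup G] [InnerProductSpace ℝ G] {t : E →ₗ[ℝ] F →ₗ[ℝ] G}
    [FiniteDimensional ℝ F]

/-- Reduction to the semistable case in the first variable. -/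
theorem devissage (ht : IsTensor t) {M : Submodule ℤ F} (hM : IsLt M) {b : ℝ} (hb : 0 ≤ b)
    (hss : ∀ (N : Submodule ℤ E) (a : ℝ), IsLt N → 0 < a → AA N a → covol N = a ^ rk N →
      rk N ≠ 0 → AA (tensorLat t N M) (a * b)) :
    ∀ (n : ℕ) (N : Submodule ℤ E), IsLt N → rk N = n → ∀ a, 0 ≤ a → AA N a →
      AA (tensorLat t N M) (a * b) := by
  intro n
  induction n using Nat.strong_induction_on with
  | _ n ih =>
  intro N hN hn a ha hA
  have := hN.1
  have hT := tensor_info ht hN hM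
  have := hT.1.1
  by_cases hn0 : rk N = 0
  · intro X hX
    have := fin_of_le hX
    have h1 : rk X = 0 := by
      have h3 : rk X ≤ _ := LinearMap.finrank_le_finrank_of_injective (Submodule.inclusion_injective hX)
      have h2 := hT.2.1
      rw [hn0, zero_mul] at h2
      have : rk X ≤ rk (tensorLat t N M) := h3
      omega
    rw [covol_of_rk_zero h1, h1, pow_zero]
  obtain ⟨h, h0, hAh, hmax⟩ := exists_best hN hn0
  refine AA.mono' (a := h * b) ?_ (by positivity) (mul_le_mul_of_nonneg_right (hmax a ha hA) hb)
  rcases h0.eq_or_lt with h0 | h0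
  · rw [← h0, zero_mul]
    exact AA_zero hT.1
  rcases (hAh N le_rfl).eq_or_lt with hc | hc
  · exact hss N h hN h0 hAh hc.symm hn0
  -- the key claim
  have key : ∀ h', h < h' → h' ^ rk N < covol N →
      AA (tensorLat t N M) (h * (h / h') ^ rk N * b) := by
    intro h' hh hc'
    have h0' : 0 < h' := h0.trans hh
    have hnot : ¬ AA N h' := fun hx => absurd (hmax h' h0'.le hx) (not_le.2 hh)
    simp only [AA, not_forall, not_le] at hnot
    obtain ⟨X, hX, hXc⟩ := hnot
    have := fin_of_le hX
    have hr := (hN.sub_aux hX).2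
    have hXK : X ≤ N ⊓ rz (sp X) := le_inf hX (fun x hx => Submodule.subset_span hx)
    have hcK : covol (N ⊓ rz (sp X)) ≤ covol X := covol_le_of_le hXK hr.symm
    have hX0 : rk X ≠ 0 := by
      intro h1
      rw [covol_of_rk_zero h1, h1, pow_zero] at hXc
      exact lt_irrefl _ hXc
    have hXn : rk X < rk N := by
      refine lt_of_le_of_ne (rk_mono hX) fun he => ?_
      have := covol_le_of_le hX he
      rw [he] at hXc
      linarith
    have hadd := rk_add' N (sp X)
    have hle : (h / h') ^ rk N ≤ 1 := pow_le_one₀ (by positivity) ((div_le_one h0').2 hh.le)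
    have hA2 := AA_quot hN hX h0 hh hAh hXc
    apply AA_tensor_ext ht hN hM (sp X) (by positivity)
    · refine ih _ (by omega) _ (hN.sub inf_le_left) hr _ (by positivity) ?_
      refine (hAh.mono inf_le_left).mono' (by positivity) ?_
      exact mul_le_of_le_one_right h0.le hle
    · refine ih _ ?_ _ (hN.quot _ (Submodule.span_mono hXK)) rfl _ (by positivity) hA2
      change rk (N.map (prz (sp X))) < n
      omega
  intro Y hY
  have hcont : Filter.Tendsto (fun h' : ℝ => (h * (h / h') ^ rk N * b) ^ rk Y) (nhdsWithin h (Set.Ioi h))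
      (nhds ((h * b) ^ rk Y)) := by
    have : ContinuousAt (fun h' : ℝ => (h * (h / h') ^ rk N * b) ^ rk Y) h := by
      have : ContinuousAt (fun h' : ℝ => h / h') h := continuousAt_const.div continuousAt_id h0.ne'
      fun_prop
    have h2 := this.tendsto
    rw [div_self h0.ne', one_pow, mul_one] at h2
    exact h2.mono_left nhdsWithin_le_nhds
  refine le_of_tendsto hcont ?_
  have hev : ∀ᶠ h' in nhds h, h' ^ rk N < covol N :=
    (continuous_pow (rk N)).continuousAt.eventually_lt continuousAt_const hc
  filter_upwards [self_mem_nhdsWithin, nhdsWithin_le_nhds hev] with h' h1 h2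
  exact key h' h1 h2 Y hY

end


theorem latIn_map (L : Submodule ℤ E) (F : Submodule ℝ E) :
    (latIn L F).map (F.subtype.restrictScalars ℤ) = L ⊓ rz F := by
  ext x
  constructor
  · rintro ⟨y, hy, rfl⟩
    exact ⟨hy, y.2⟩
  · rintro ⟨hx, hF⟩
    exact ⟨⟨x, hF⟩, hx, rfl⟩

theorem latIn_covol {L : Submodule ℤ E} [Module.Finite ℤ L] (F : Submodule ℝ E) :
    Module.Finite ℤ (latIn L F) ∧ rk (latIn L F) = rk (L ⊓ rz F) ∧
      covol (latIn L F) = covol (L ⊓ rz F) := by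
  have hfin : Module.Finite ℤ (latIn L F) := by
    have e := mapEquiv (latIn L F) (F.subtype.restrictScalars ℤ) (by
      intro x _ h
      exact Subtype.ext h)
    rw [latIn_map] at e
    exact Module.Finite.equiv e.symm
  have := covol_map_iso (latIn L F) (F.subtype.restrictScalars ℤ) (fun x _ y _ => rfl)
  rw [latIn_map] at this
  exact ⟨hfin, this.1.symm, this.2.symm⟩

theorem inf_sp (L : Submodule ℤ E) : L ⊓ rz (sp L) = L :=
  inf_eq_left.2 fun _ hx => Submodule.subset_span hx

theorem rational_sp {L X : Submodule ℤ E} (h : X ≤ L) : IsRational L (sp X) := by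
  apply le_antisymm
  · rw [Submodule.span_le]
    exact Set.inter_subset_right
  · exact Submodule.span_mono fun x hx => ⟨h hx, Submodule.subset_span hx⟩

theorem rational_eq {L : Submodule ℤ E} {F : Submodule ℝ E} (h : IsRational L F) :
    sp (L ⊓ rz F) = F := h

theorem isLat_isLt [FiniteDimensional ℝ E] {L : Submodule ℤ E} (h : IsLat L) :
    IsLt L ∧ sp L = ⊤ := by
  have := h.1
  refine ⟨⟨inferInstance, ?_⟩, h.2⟩
  have e := Real.finrank_eq_int_finrank_of_discrete (s := (L : Set E)) (by
    rw [Submodule.span_eq]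
    exact this)
  rw [Set.finrank, Set.finrank, Submodule.span_eq] at e
  exact e

section
variable [FiniteDimensional ℝ E] {L : Submodule ℤ E}

theorem Hr_eq (hL : IsLt L) {F : Submodule ℝ E} (hF : IsRational L F) :
    Hr L F = covol (L ⊓ rz F) ^ ((rk (L ⊓ rz F) : ℝ)⁻¹) := by
  have := hL.1
  have h1 := (hL.sub (X := L ⊓ rz F) inf_le_left).2
  rw [rational_eq hF] at h1
  rw [Hr, redH, h1, (latIn_covol F).2.2]

theorem rk_ne_zero (hL : IsLt L) {F : Submodule ℝ E} (hF : IsRational L F) (h0 : F ≠ ⊥) :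
    rk (L ⊓ rz F) ≠ 0 := by
  have h1 := (hL.sub (X := L ⊓ rz F) inf_le_left).2
  rw [rational_eq hF] at h1
  rw [← h1]
  exact fun h => h0 (Submodule.finrank_eq_zero.1 h)

theorem Hr_pos (hL : IsLt L) {F : Submodule ℝ E} (hF : IsRational L F) : 0 < Hr L F := by
  rw [Hr_eq hL hF]
  exact Real.rpow_pos_of_pos (hL.sub inf_le_left).covol_pos _

theorem Hr_pow (hL : IsLt L) {F : Submodule ℝ E} (hF : IsRational L F) (h0 : F ≠ ⊥) :
    Hr L F ^ rk (L ⊓ rz F) = covol (L ⊓ rz F) := by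
  rw [Hr_eq hL hF]
  exact Real.rpow_inv_natCast_pow (covol_nonneg _) (rk_ne_zero hL hF h0)

theorem AA.le_Hr {a : ℝ} (h : AA L a) (hL : IsLt L) {F : Submodule ℝ E}
    (hF : IsRational L F) (h0 : F ≠ ⊥) : a ≤ Hr L F := by
  have h1 := h (L ⊓ rz F) inf_le_left
  rw [← Hr_pow hL hF h0] at h1
  exact le_of_pow_le_pow_left₀ (rk_ne_zero hL hF h0) (Hr_pos hL hF).le h1

theorem sp_ne_bot (hL : IsLt L) {X : Submodule ℤ E} (hX : X ≤ L) (h : rk X ≠ 0) : sp X ≠ ⊥ := by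
  intro hb
  have h1 := (hL.sub hX).2
  rw [hb, finrank_bot] at h1
  exact h h1.symm

theorem AA.le_Hmin {a : ℝ} (h : AA L a) (hL : IsLt L) (h0 : rk L ≠ 0) : a ≤ Hmin L := by
  apply le_csInf
  · exact ⟨_, sp L, sp_ne_bot hL le_rfl h0, rational_sp le_rfl, rfl⟩
  · rintro _ ⟨F, hF0, hF, rfl⟩
    exact h.le_Hr hL hF hF0

theorem Hmin_nonneg (hL : IsLt L) : 0 ≤ Hmin L := by
  apply Real.sInf_nonneg
  rintro _ ⟨F, _, hF, rfl⟩
  exact (Hr_pos hL hF).le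

theorem Hmin_le (hL : IsLt L) {F : Submodule ℝ E} (hF : IsRational L F) (h0 : F ≠ ⊥) :
    Hmin L ≤ Hr L F := by
  refine csInf_le ⟨0, ?_⟩ ⟨F, h0, hF, rfl⟩
  rintro _ ⟨F, _, hF, rfl⟩
  exact (Hr_pos hL hF).le

theorem AA_Hmin (hL : IsLt L) : AA L (Hmin L) := by
  intro X hX
  have := hL.1
  have := fin_of_le hX
  by_cases h : rk X = 0
  · rw [covol_of_rk_zero h, h, pow_zero]
  have hb := sp_ne_bot hL hX h
  have hr := rational_sp hX
  have h1 := Hmin_le hL hr hb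
  have h2 := (hL.sub_aux hX).2
  have hXK : X ≤ L ⊓ rz (sp X) := le_inf hX (fun x hx => Submodule.subset_span hx)
  refine le_trans ?_ (covol_le_of_le hXK h2.symm)
  rw [← Hr_pow hL hr hb, ← h2]
  exact pow_le_pow_left₀ (Hmin_nonneg hL) h1 _

theorem AA.semistable {a : ℝ} (h : AA L a) (hL : IsLt L) (hsp : sp L = ⊤) (ha : 0 ≤ a)
    (h0 : rk L ≠ 0) (hc : covol L = a ^ rk L) : Semistable L := by
  intro F hF0 hF
  have h1 := hL.2
  rw [hsp, finrank_top] at h1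
  have : redH L = a := by
    rw [redH, h1, hc, Real.pow_rpow_inv_natCast ha h0]
  rw [this]
  exact h.le_Hr hL hF hF0

end


theorem dual_exists {ι : Type*} [Fintype ι] [DecidableEq ι] (v : ι → E)
    (hv : LinearIndependent ℝ v) : ∃ z : ι → E, (∀ j, z j ∈ Submodule.span ℝ (Set.range v)) ∧
      (∀ i j, inner ℝ (v i) (z j) = if i = j then (1 : ℝ) else 0) ∧ gd z * gd v = 1 := by
  have hg := (gd_pos_iff v).2 hv
  have hdet : (Matrix.gram ℝ v).det = gd v := rfl
  have hu : IsUnit (Matrix.gram ℝ v).det := by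
    rw [hdet]
    exact hg.ne'.isUnit
  refine ⟨fun j => ∑ l, (Matrix.gram ℝ v)⁻¹ j l • v l, fun j => ?_, fun i j => ?_, ?_⟩
  · exact Submodule.sum_mem _ fun l _ => Submodule.smul_mem _ _ (Submodule.subset_span ⟨l, rfl⟩)
  · rw [inner_sum]
    simp only [real_inner_smul_right]
    have := congrFun (congrFun (Matrix.nonsing_inv_mul _ hu) j) i
    rw [Matrix.mul_apply, Matrix.one_apply] at this
    simp only [Matrix.gram_apply] at this
    simp only [real_inner_comm (v _) (v i)] at this ⊢
    rw [this]
    simp [eq_comm]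
  · rw [gd_lin, Matrix.det_nonsing_inv, hdet, Ring.inverse_eq_inv']
    field_simp

theorem gd_smul {ι : Type*} [Fintype ι] [DecidableEq ι] (c : ℝ) (w : ι → E) :
    gd (fun i => c • w i) = (c ^ Fintype.card ι) ^ 2 * gd w := by
  have := gd_lin (Matrix.diagonal fun _ => c) w
  simp only [Matrix.det_diagonal, Finset.prod_const, Finset.card_univ] at this
  rw [← this]
  congr 1
  ext i
  simp [Matrix.diagonal_apply]

theorem eq_zero_of_span {ι : Type*} {v : ι → E} {y : E}
    (hy : y ∈ Submodule.span ℝ (Set.range v)) (h : ∀ i, inner ℝ (v i) y = (0 : ℝ)) : y = 0 := by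
  have : ∀ x ∈ Submodule.span ℝ (Set.range v), inner ℝ x y = (0 : ℝ) := by
    intro x hx
    induction hx using Submodule.span_induction with
    | mem x hx =>
      obtain ⟨i, rfl⟩ := hx
      exact h i
    | zero => simp
    | add u v _ _ hu hv => rw [inner_add_left, hu, hv, add_zero]
    | smul a u _ hu => rw [real_inner_smul_left, hu, mul_zero]
  exact inner_self_eq_zero.1 (this y hy)

/-- expansion of elements with integral pairings in the dual basis -/
theorem mem_span_dual {ι : Type*} [Fintype ι] [DecidableEq ι] {v z : ι → E} {y : E} {σ : Equiv.Perm ι}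
    (hy : y ∈ Submodule.span ℝ (Set.range v)) (hz : ∀ j, z j ∈ Submodule.span ℝ (Set.range v))
    (hvz : ∀ i j, inner ℝ (v i) (z j) = if i = σ j then (1 : ℝ) else 0)
    (h : ∀ i, ∃ n : ℤ, inner ℝ (v i) y = (n : ℝ)) : y ∈ Submodule.span ℤ (Set.range z) := by
  choose n hn using h
  have : y = ∑ j, n (σ j) • z j := by
    rw [← sub_eq_zero]
    apply eq_zero_of_span (v := v)
    · refine Submodule.sub_mem _ hy (Submodule.sum_mem _ fun j _ => ?_)
      rw [← Int.cast_smul_eq_zsmul ℝ]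
      exact Submodule.smul_mem _ _ (hz j)
    · intro i
      rw [inner_sub_right, hn, inner_sum]
      simp only [← Int.cast_smul_eq_zsmul ℝ, real_inner_smul_right, hvz, mul_ite, mul_one, mul_zero]
      rw [Finset.sum_eq_single (σ.symm i)]
      · simp
      · intro j _ hj
        rw [if_neg]
        rintro rfl
        simp at hj
      · simp
  rw [this]
  exact Submodule.sum_mem _ fun j _ => Submodule.smul_mem _ _ (Submodule.subset_span ⟨j, rfl⟩)

theorem inner_int_span {ι κ : Type*} {v : ι → E} {w : κ → E} {c : ℝ}
    (h : ∀ i j, ∃ n : ℤ, inner ℝ (v i) (w j) = c * n) {x y : E}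
    (hx : x ∈ Submodule.span ℤ (Set.range v)) (hy : y ∈ Submodule.span ℤ (Set.range w)) :
    ∃ n : ℤ, inner ℝ x y = c * n := by
  induction hx, hy using Submodule.span_induction₂ with
  | mem_mem x y hx hy =>
    obtain ⟨i, rfl⟩ := hx
    obtain ⟨j, rfl⟩ := hy
    exact h i j
  | zero_left y hy => exact ⟨0, by simp⟩
  | zero_right y hy => exact ⟨0, by simp⟩
  | add_left x y z _ _ _ h1 h2 =>
    obtain ⟨m, hm⟩ := h1
    obtain ⟨n, hn⟩ := h2
    exact ⟨m + n, by rw [inner_add_left, hm, hn]; push_cast; ring⟩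
  | add_right x y z _ _ _ h1 h2 =>
    obtain ⟨m, hm⟩ := h1
    obtain ⟨n, hn⟩ := h2
    exact ⟨m + n, by rw [inner_add_right, hm, hn]; push_cast; ring⟩
  | smul_left r x y _ _ h1 =>
    obtain ⟨m, hm⟩ := h1
    exact ⟨r * m, by
      rw [← Int.cast_smul_eq_zsmul ℝ, real_inner_smul_left, hm]; push_cast; ring⟩
  | smul_right r x y _ _ h1 =>
    obtain ⟨m, hm⟩ := h1
    exact ⟨r * m, by
      rw [← Int.cast_smul_eq_zsmul ℝ, real_inner_smul_right, hm]; push_cast; ring⟩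

theorem isodual_of_basis {κ : Type*} [Fintype κ] [DecidableEq κ] (u : κ → E)
    (hu : Submodule.span ℝ (Set.range u) = ⊤) (τ : E →ₗ[ℝ] E) (σ : Equiv.Perm κ)
    (h : ∀ i j, inner ℝ (u i) (τ (u j)) = if i = σ j then (1 : ℝ) else 0) :
    (Submodule.span ℤ (Set.range u)).map (τ.restrictScalars ℤ) =
      dualLat (Submodule.span ℤ (Set.range u)) := by
  rw [Submodule.map_span, ← Set.range_comp]
  apply le_antisymm
  · intro y hy x hx
    obtain ⟨n, hn⟩ := inner_int_span (c := 1) (w := ⇑(τ.restrictScalars ℤ) ∘ u) (fun i j => by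
      simp only [Function.comp_apply, LinearMap.coe_restrictScalars, h]
      by_cases hij : i = σ j
      · exact ⟨1, by simp [hij]⟩
      · exact ⟨0, by simp [hij]⟩) hx hy
    exact ⟨n, by rw [hn, one_mul]⟩
  · intro y hy
    refine mem_span_dual (v := u) (σ := σ) ?_ ?_ h fun i => hy _ (Submodule.subset_span ⟨i, rfl⟩)
    · rw [hu]; trivial
    · intro j; rw [hu]; trivial

/-- The (scaled) dual of a semistable lattice is semistable. -/
theorem AA_dual [FiniteDimensional ℝ E] {ι : Type*} [Fintype ι] [DecidableEq ι] {L : Submodule ℤ E}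
    (hL : IsLt L) (hsp : sp L = ⊤) {a : ℝ} (ha : 0 < a) (hA : AA L a) (hc : covol L = a ^ rk L)
    (b : Basis ι ℤ L) (w : ι → E) (hbw : ∀ i j, inner ℝ (b i : E) (w j) = if i = j then (1 : ℝ) else 0)
    (hD : IsLt (Submodule.span ℤ (Set.range fun i => (a ^ 2) • w i))) :
    AA (Submodule.span ℤ (Set.range fun i => (a ^ 2) • w i)) a := by
  intro X hX
  have := hL.1
  have := hD.1
  have := fin_of_le hX
  have hXl := hD.sub hX
  set k := rk X with hk
  set x : Fin k → E := fun i => (bas X i : E) with hx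
  have hxli : LinearIndependent ℝ x := hXl.li _
  obtain ⟨z, hz1, hz2, hz3⟩ := dual_exists x hxli
  let p := pr (sp X)ᗮ
  have hspx : Submodule.span ℝ (Set.range x) = sp X := sp_basis X (bas X)
  have hp1 : ∀ y, p y ∈ sp X := fun y => by
    have := pr_mem (sp X)ᗮ y
    rwa [Submodule.orthogonal_orthogonal] at this
  have hp2 : ∀ y, y - p y ∈ (sp X)ᗮ := fun y => sub_pr_mem _ y
  set D := Submodule.span ℤ (Set.range fun i => (a ^ 2) • z i) with hDdef
  have ha2 : a ^ 2 ≠ 0 := by positivity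
  have hzli : LinearIndependent ℝ (fun i => (a ^ 2) • z i) := by
    rw [← gd_pos_iff, gd_smul]
    have : 0 < gd z := (gd_nonneg z).lt_of_ne' fun h => by
      rw [h, zero_mul] at hz3
      exact zero_ne_one hz3
    positivity
  obtain ⟨hD1, hD2, hD3⟩ := isLt_of_li _ hzli D rfl
  rw [Fintype.card_fin] at hD2
  have hpD : L.map (p.restrictScalars ℤ) ≤ D := by
    rintro _ ⟨y, hy, rfl⟩
    change p y ∈ D
    have h1 : (a ^ 2)⁻¹ • p y ∈ Submodule.span ℤ (Set.range z) := by
      refine mem_span_dual (v := x) (σ := Equiv.refl _) ?_ hz1 hz2 ?_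
      · rw [hspx]
        exact Submodule.smul_mem _ _ (hp1 y)
      · intro i
        have hxi : x i ∈ X := (bas X i).2
        obtain ⟨n, hn⟩ := inner_int_span (c := a ^ 2) (v := fun i => (b i : E))
          (w := fun i => (a ^ 2) • w i) (fun i j => by
          rw [real_inner_smul_right, hbw]
          by_cases hij : i = j
          · exact ⟨1, by simp [hij]⟩
          · exact ⟨0, by simp [hij]⟩) (by rw [span_coe_basis]; exact hy) (hX hxi)
        refine ⟨n, ?_⟩
        have h3 : inner ℝ (x i) (y - p y) = (0 : ℝ) := hp2 y _ (Submodule.subset_span hxi)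
        rw [inner_sub_right, sub_eq_zero] at h3
        rw [real_inner_smul_right, ← h3, real_inner_comm, hn]
        field_simp
    have h2 : p y = (a ^ 2) • ((a ^ 2)⁻¹ • p y) := by rw [smul_inv_smul₀ ha2]
    rw [h2]
    generalize (a ^ 2)⁻¹ • p y = q at h1
    induction h1 using Submodule.span_induction with
    | mem q hq =>
      obtain ⟨i, rfl⟩ := hq
      exact Submodule.subset_span ⟨i, rfl⟩
    | zero => simp
    | add u v _ _ hu hv => rw [smul_add]; exact Submodule.add_mem _ hu hv
    | smul m u _ hu => rw [smul_comm]; exact Submodule.smul_mem _ _ hu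
  have hDfin := hD1.1
  have hrle : rk (L.map (p.restrictScalars ℤ)) ≤ k := by
    rw [← hD2]
    exact rk_mono hpD
  have hrge : k ≤ rk (L.map (p.restrictScalars ℤ)) := by
    refine le_trans ?_ (finrank_sp_le _)
    have hXl2 : finrank ℝ (sp X) = k := hXl.2
    rw [← hXl2]
    apply Submodule.finrank_mono
    intro y hy
    have hpy : p y = y := by
      apply pr_eq
      · rwa [Submodule.orthogonal_orthogonal]
      · simp
    rw [← hpy]
    have hyL : y ∈ sp L := by rw [hsp]; trivial
    exact Submodule.apply_mem_span_image_of_mem_span p hyL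
  have hr : rk (L.map (p.restrictScalars ℤ)) = rk D := by omega
  have h1 := covol_le_of_le hpD hr
  have h2 := covol_ext_le L p (norm_pr_le _)
  have h3 := rk_add L (p.restrictScalars ℤ)
  have h4 := hA (L ⊓ LinearMap.ker (p.restrictScalars ℤ)) inf_le_left
  set m := rk (L ⊓ LinearMap.ker (p.restrictScalars ℤ))
  rw [hr, hD2] at h3
  rw [hD3, gd_smul, Real.sqrt_mul (by positivity), Real.sqrt_sq (by positivity),
    Fintype.card_fin] at h1
  have h5 : √ (gd z) * covol X = 1 := by
    rw [covol_eq X (bas X), ← Real.sqrt_mul (gd_nonneg _), hz3, Real.sqrt_one]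
  have h6 : a ^ m * ((a ^ 2) ^ k * √ (gd z)) ≤ a ^ m * a ^ k := by
    rw [← pow_add, ← h3, ← hc]
    refine le_trans (mul_le_mul h4 h1 (by positivity) (covol_nonneg _)) h2
  have h7 : (a ^ 2) ^ k * √ (gd z) ≤ a ^ k := le_of_mul_le_mul_left h6 (by positivity)
  rw [← pow_mul, two_mul, pow_add, mul_assoc] at h7
  have h8 : a ^ k * √ (gd z) ≤ 1 := by
    have : a ^ k * (a ^ k * √ (gd z)) ≤ a ^ k * 1 := by rwa [mul_one]
    exact le_of_mul_le_mul_left this (by positivity)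
  calc a ^ k = a ^ k * (√ (gd z) * covol X) := by rw [h5, mul_one]
    _ = (a ^ k * √ (gd z)) * covol X := by ring
    _ ≤ 1 * covol X := mul_le_mul_of_nonneg_right h8 (covol_nonneg X)
    _ = covol X := one_mul _


theorem isLat_of_li [FiniteDimensional ℝ E] {κ : Type*} [Fintype κ] [DecidableEq κ] (u : κ → E)
    (hu : LinearIndependent ℝ u) (hs : Submodule.span ℝ (Set.range u) = ⊤) :
    IsLat (Submodule.span ℤ (Set.range u)) := by
  refine ⟨?_, ?_⟩
  · let B := Basis.mk hu hs.ge
    have : DiscreteTopology (Submodule.span ℤ (Set.range B)) := inferInstance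
    rwa [Basis.coe_mk] at this
  · rw [Submodule.span_span_of_tower, hs]

/-- Embedding a semistable lattice in a semistable isodual one. -/
theorem isodual_full [FiniteDimensional ℝ E] {L : Submodule ℤ E}
    (hL : IsLt L) (hsp : sp L = ⊤) {a : ℝ} (ha : 0 < a) (hA : AA L a) (hc : covol L = a ^ rk L)
    (h0 : rk L ≠ 0) :
    ∃ L2 : Submodule ℤ (WithLp 2 (E × E)), IsLat L2 ∧ Semistable L2 ∧ (∃ τ, IsIsodual L2 τ) ∧
      AA L2 a ∧ rk L2 ≠ 0 ∧ ∀ x ∈ L, WithLp.toLp 2 (x, (0 : E)) ∈ L2 := by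
  have := hL.1
  let b := bas L
  let v : Fin (rk L) → E := fun i => (b i : E)
  have hv : LinearIndependent ℝ v := hL.li b
  have hvs : Submodule.span ℝ (Set.range v) = ⊤ := (sp_basis L b).trans hsp
  obtain ⟨w, -, hvw, hgw⟩ := dual_exists v hv
  have hgv : 0 < gd v := (gd_pos_iff v).2 hv
  have hgw0 : 0 < gd w := (gd_nonneg w).lt_of_ne' fun h => by
    rw [h, zero_mul] at hgw
    exact zero_ne_one hgw
  have ha2 : a ^ 2 ≠ 0 := by positivity
  have hwli : LinearIndependent ℝ (fun i => (a ^ 2) • w i) := by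
    rw [← gd_pos_iff, gd_smul]
    positivity
  set L' := Submodule.span ℤ (Set.range fun i => (a ^ 2) • w i) with hL'
  obtain ⟨hD, -, -⟩ := isLt_of_li _ hwli L' rfl
  have hA' : AA L' a := AA_dual hL hsp ha hA hc b w hvw hD
  let u1 : Fin (rk L) → WithLp 2 (E × E) := fun i => WithLp.toLp 2 (v i, (0 : E))
  let u2 : Fin (rk L) → WithLp 2 (E × E) := fun i => WithLp.toLp 2 ((0 : E), (a ^ 2) • w i)
  let u := Sum.elim u1 u2
  have hgu : gd u = (a ^ (rk L + rk L)) ^ 2 := by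
    have h1 : gd u = gd u1 * gd u2 := by
      apply gd_block
      · intro i j
        simp [u1, u2, WithLp.prod_inner_apply]
      · intro j
        simp
    have h2 : gd u1 = gd v := by
      rw [gd, gd]
      congr 1
      ext i j
      simp [Matrix.gram_apply, u1, WithLp.prod_inner_apply]
    have h3 : gd u2 = gd (fun i => (a ^ 2) • w i) := by
      rw [gd, gd]
      congr 1
      ext i j
      simp [Matrix.gram_apply, u2, WithLp.prod_inner_apply]
    rw [h1, h2, h3, gd_smul, Fintype.card_fin]
    calc gd v * (((a ^ 2) ^ rk L) ^ 2 * gd w) = ((a ^ 2) ^ rk L) ^ 2 * (gd w * gd v) := by ring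
      _ = _ := by rw [hgw]; ring
  have huli : LinearIndependent ℝ u := by
    rw [← gd_pos_iff, hgu]
    positivity
  have hus : Submodule.span ℝ (Set.range u) = ⊤ := by
    apply huli.span_eq_top_of_card_eq_finrank'
    have e1 := (WithLp.linearEquiv 2 ℝ (E × E)).finrank_eq
    have e2 := hL.2
    rw [hsp, finrank_top] at e2
    rw [e1, finrank_prod, e2]
    simp
  obtain ⟨hl1, hl2, hl3⟩ := isLt_of_li u huli _ rfl
  rw [Fintype.card_sum, Fintype.card_fin] at hl2
  rw [hgu, Real.sqrt_sq (by positivity), ← hl2] at hl3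
  set L2 := Submodule.span ℤ (Set.range u) with hL2
  have hlat : IsLat L2 := isLat_of_li u huli hus
  have hfin := hl1.1
  let f1 : WithLp 2 (E × E) →ₗ[ℝ] E := LinearMap.fst ℝ E E ∘ₗ (WithLp.linearEquiv 2 ℝ (E × E)).toLinearMap
  let f2 : WithLp 2 (E × E) →ₗ[ℝ] E := LinearMap.snd ℝ E E ∘ₗ (WithLp.linearEquiv 2 ℝ (E × E)).toLinearMap
  have hf1 : ∀ x, f1 x = x.fst := fun x => rfl
  have hf2 : ∀ x, f2 x = x.snd := fun x => rfl
  have hm1 : L2 ≤ L.comap (f1.restrictScalars ℤ) := by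
    rw [hL2, Submodule.span_le]
    rintro _ ⟨i | i, rfl⟩
    · exact (b i).2
    · exact L.zero_mem
  have hm2 : L2 ≤ L'.comap (f2.restrictScalars ℤ) := by
    rw [hL2, Submodule.span_le]
    rintro _ ⟨i | i, rfl⟩
    · exact L'.zero_mem
    · exact Submodule.subset_span ⟨i, rfl⟩
  have hA2 : AA L2 a := by
    apply AA.ext ha.le f2
    · intro x
      rw [hf2]
      refine abs_le_of_sq_le_sq' ?_ (norm_nonneg _) |>.2
      rw [WithLp.prod_norm_sq_eq_of_L2]
      nlinarith [sq_nonneg ‖x.fst‖]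
    · apply AA.of_iso (f1.restrictScalars ℤ)
      · rintro x ⟨-, hx⟩ y ⟨-, hy⟩
        have hx' : x.snd = 0 := hx
        rw [WithLp.prod_inner_apply]
        change _ = inner ℝ x.fst y.fst + inner ℝ x.snd y.snd
        rw [hx', inner_zero_left, add_zero]
        rfl
      · apply hA.mono
        rintro _ ⟨x, ⟨hx, -⟩, rfl⟩
        exact hm1 hx
    · apply hA'.mono
      rintro _ ⟨x, hx, rfl⟩
      exact hm2 hx
  have hr0 : rk L2 ≠ 0 := by omega
  refine ⟨L2, hlat, hA2.semistable hl1 (isLat_isLt hlat).2 ha.le hr0 hl3, ?_, hA2, hr0, ?_⟩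
  · let e := WithLp.linearEquiv 2 ℝ (E × E)
    let τ : WithLp 2 (E × E) →ₗ[ℝ] WithLp 2 (E × E) :=
      (a ^ 2)⁻¹ • (e.symm.toLinearMap ∘ₗ (LinearEquiv.prodComm ℝ E E).toLinearMap ∘ₗ e.toLinearMap)
    have hτ : ∀ x, τ x = (a ^ 2)⁻¹ • WithLp.toLp 2 (x.snd, x.fst) := fun x => rfl
    refine ⟨τ, ⟨(a ^ 2)⁻¹ ^ 2, by positivity, ?_⟩, ?_⟩
    · intro x y
      rw [hτ, hτ, real_inner_smul_left, real_inner_smul_right, WithLp.prod_inner_apply,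
        WithLp.prod_inner_apply]
      simp only [WithLp.ofLp_fst, WithLp.ofLp_snd]
      ring
    · apply isodual_of_basis u hus τ (Equiv.sumComm _ _)
      rintro (i | i) (j | j)
      · simp [hτ, u, u1, u2, real_inner_smul_right, WithLp.prod_inner_apply]
      · simp [hτ, u, u1, u2, real_inner_smul_right, WithLp.prod_inner_apply, hvw, ha.ne']
      · simp [hτ, u, u1, u2, real_inner_smul_right, real_inner_smul_left, WithLp.prod_inner_apply, ha.ne']
        rw [real_inner_comm, hvw]
        simp [eq_comm]
      · simp [hτ, u, u1, u2, real_inner_smul_right, WithLp.prod_inner_apply]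
  · intro x hx
    rw [← span_coe_basis L b] at hx
    induction hx using Submodule.span_induction with
    | mem x hx =>
      obtain ⟨i, rfl⟩ := hx
      exact Submodule.subset_span ⟨Sum.inl i, rfl⟩
    | zero => exact L2.zero_mem
    | add x y _ _ hx hy =>
      have : WithLp.toLp 2 (x + y, (0 : E)) = WithLp.toLp 2 (x, (0 : E)) + WithLp.toLp 2 (y, (0 : E)) := by
        rw [← WithLp.toLp_add, Prod.mk_add_mk, add_zero]
      rw [this]
      exact L2.add_mem hx hy
    | smul m x _ hx =>
      have : WithLp.toLp 2 (m • x, (0 : E)) = m • WithLp.toLp 2 (x, (0 : E)) := by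
        rw [← WithLp.toLp_smul, Prod.smul_mk, smul_zero]
      rw [this]
      exact L2.smul_mem m hx

theorem isodual_exists [FiniteDimensional ℝ E] {N : Submodule ℤ E}
    (hN : IsLt N) {a : ℝ} (ha : 0 < a) (hA : AA N a) (hc : covol N = a ^ rk N)
    (h0 : rk N ≠ 0) :
    ∃ (L2 : Submodule ℤ (WithLp 2 (sp N × sp N))) (ψ : E →ₗ[ℝ] WithLp 2 (sp N × sp N)),
      IsLat L2 ∧ Semistable L2 ∧ (∃ τ, IsIsodual L2 τ) ∧
      AA L2 a ∧ rk L2 ≠ 0 ∧ (∀ x ∈ N, ψ x ∈ L2) ∧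
      ∀ x ∈ N, ∀ y ∈ N, inner ℝ (ψ x) (ψ y) = (inner ℝ x y : ℝ) := by
  have := hN.1
  obtain ⟨hf, hr, hcv⟩ := latIn_covol (L := N) (sp N)
  rw [inf_sp] at hr hcv
  have hsp : sp (latIn N (sp N)) = ⊤ := by
    have h1 := Submodule.span_span_coe_preimage (R := ℝ) (s := (N : Set E))
    exact h1
  have hL : IsLt (latIn N (sp N)) := by
    refine ⟨hf, ?_⟩
    rw [hsp, finrank_top, hN.2, hr]
  have hAL : AA (latIn N (sp N)) a := by
    apply AA.of_iso ((sp N).subtype.restrictScalars ℤ) (fun x _ y _ => rfl)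
    rw [latIn_map, inf_sp]
    exact hA
  obtain ⟨L2, g1, g2, g3, g4, g5, g6⟩ := isodual_full hL hsp ha hAL (by rw [hcv, hc, hr])
    (by rwa [hr])
  let ψ : E →ₗ[ℝ] WithLp 2 (sp N × sp N) :=
    (WithLp.linearEquiv 2 ℝ (sp N × sp N)).symm.toLinearMap ∘ₗ LinearMap.inl ℝ (sp N) (sp N) ∘ₗ
      ((sp N).orthogonalProjectionOnto : E →ₗ[ℝ] sp N)
  have hψ : ∀ x, ∀ hx : x ∈ N, ψ x = WithLp.toLp 2 ((⟨x, Submodule.subset_span hx⟩ : sp N), (0 : sp N)) := by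
    intro x hx
    have : (sp N).orthogonalProjectionOnto x = (⟨x, Submodule.subset_span hx⟩ : sp N) :=
      Submodule.orthogonalProjectionOnto_mem_subspace_eq_self (⟨x, Submodule.subset_span hx⟩ : sp N)
    change WithLp.toLp 2 ((sp N).orthogonalProjectionOnto x, (0 : sp N)) = _
    rw [this]
  refine ⟨L2, ψ, g1, g2, g3, g4, g5, ?_, ?_⟩
  · intro x hx
    rw [hψ x hx]
    exact g6 _ hx
  · intro x hx y hy
    rw [hψ x hx, hψ y hy, WithLp.prod_inner_apply]
    simp


universe uu vv

/-- The hypothesis: multiplicativity for semistable isodual lattices. -/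
def HypH : Prop := ∀ (E : Type uu) (F : Type uu) [NormedAddCommGroup E] [InnerProductSpace ℝ E]
      [FiniteDimensional ℝ E] [NormedAddCommGroup F] [InnerProductSpace ℝ F]
      [FiniteDimensional ℝ F] (L : Submodule ℤ E) (M : Submodule ℤ F),
      IsLat L → IsLat M → Semistable L → Semistable M →
      (∃ τ : E →ₗ[ℝ] E, IsIsodual L τ) → (∃ υ : F →ₗ[ℝ] F, IsIsodual M υ) →
      ∀ (G : Type vv) [NormedAddCommGroup G] [InnerProductSpace ℝ G]
        (tp : E →ₗ[ℝ] F →ₗ[ℝ] G), IsTensor tp →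
        Hmin (tensorLat tp L M) = Hmin L * Hmin M

theorem exists_tensor (E F : Type uu) [NormedAddCommGroup E] [InnerProductSpace ℝ E]
    [FiniteDimensional ℝ E] [NormedAddCommGroup F] [InnerProductSpace ℝ F]
    [FiniteDimensional ℝ F] : ∃ (k : ℕ) (t : E →ₗ[ℝ] F →ₗ[ℝ] EuclideanSpace ℝ (ULift.{vv} (Fin k))),
      IsTensor t := by
  let o := (stdOrthonormalBasis ℝ (TensorProduct ℝ E F)).reindex Equiv.ulift.{vv}.symm
  let e := o.repr
  refine ⟨_, (TensorProduct.mk ℝ E F).compr₂ e.toLinearEquiv.toLinearMap, ?_, ?_⟩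
  · have : TensorProduct.lift ((TensorProduct.mk ℝ E F).compr₂ e.toLinearEquiv.toLinearMap) =
        e.toLinearEquiv.toLinearMap := by
      ext x y
      simp
    rw [this]
    exact e.bijective
  · intro x x' y y'
    simp only [LinearMap.compr₂_apply, TensorProduct.mk_apply]
    exact (e.inner_map_map _ _).trans (by simp)

theorem flip_tensor {E F G : Type*} [NormedAddCommGroup E] [InnerProductSpace ℝ E]
    [NormedAddCommGroup F] [InnerProductSpace ℝ F]
    [NormedAddCommGroup G] [InnerProductSpace ℝ G] {t : E →ₗ[ℝ] F →ₗ[ℝ] G} (ht : IsTensor t) :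
    IsTensor t.flip := by
  refine ⟨?_, ?_⟩
  · have : TensorProduct.lift t.flip =
        (TensorProduct.lift t) ∘ₗ (TensorProduct.comm ℝ F E).toLinearMap := by
      ext x y
      simp
    rw [this, LinearMap.coe_comp]
    exact ht.1.comp (TensorProduct.comm ℝ F E).bijective
  · intro x x' y y'
    rw [LinearMap.flip_apply, LinearMap.flip_apply, ht.2, mul_comm]

theorem flip_lat {E F G : Type*} [NormedAddCommGroup E] [InnerProductSpace ℝ E]
    [NormedAddCommGroup F] [InnerProductSpace ℝ F]
    [NormedAddCommGroup G] [InnerProductSpace ℝ G] (t : E →ₗ[ℝ] F →ₗ[ℝ] G)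
    (N : Submodule ℤ E) (M : Submodule ℤ F) : tensorLat t.flip M N = tensorLat t N M := by
  rw [tensorLat, tensorLat, Set.image2_swap]
  rfl

section
variable {E F : Type uu} {G : Type vv} [NormedAddCommGroup E] [InnerProductSpace ℝ E]
  [FiniteDimensional ℝ E] [NormedAddCommGroup F] [InnerProductSpace ℝ F]
  [FiniteDimensional ℝ F] [NormedAddCommGroup G] [InnerProductSpace ℝ G]
  {t : E →ₗ[ℝ] F →ₗ[ℝ] G}

theorem ss_case (H : HypH.{uu, vv}) (ht : IsTensor t) {N : Submodule ℤ E} {M : Submodule ℤ F} {a b : ℝ}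
    (hN : IsLt N) (ha : 0 < a) (hA : AA N a) (hc : covol N = a ^ rk N) (h0 : rk N ≠ 0)
    (hM : IsLt M) (hb : 0 < b) (hB : AA M b) (hd : covol M = b ^ rk M) (h0' : rk M ≠ 0) :
    AA (tensorLat t N M) (a * b) := by
  obtain ⟨L2, ψ, f1, f2, f3, f4, f5, f6, f7⟩ := isodual_exists hN ha hA hc h0
  obtain ⟨M2, φ, g1, g2, g3, g4, g5, g6, g7⟩ := isodual_exists hM hb hB hd h0'
  obtain ⟨k, t2, ht2⟩ := exists_tensor.{uu, vv} (WithLp 2 (sp N × sp N)) (WithLp 2 (sp M × sp M))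
  have hH := H _ _ L2 M2 f1 g1 f2 g2 f3 g3 _ t2 ht2
  obtain ⟨fl, -⟩ := isLat_isLt f1
  obtain ⟨gl, -⟩ := isLat_isLt g1
  obtain ⟨i1, -, -⟩ := tensor_info ht hN hM
  obtain ⟨j1, j2, -⟩ := tensor_info ht2 fl gl
  have hAT : AA (tensorLat t2 L2 M2) (a * b) := by
    refine (AA_Hmin j1).mono' (by positivity) ?_
    rw [hH]
    exact mul_le_mul (f4.le_Hmin fl f5) (g4.le_Hmin gl g5) hb.le (Hmin_nonneg fl)
  let e := LinearEquiv.ofBijective _ ht.1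
  let J : G →ₗ[ℝ] EuclideanSpace ℝ (ULift.{vv} (Fin k)) :=
    TensorProduct.lift (t2.compl₁₂ ψ φ) ∘ₗ e.symm.toLinearMap
  have hJ : ∀ x y, J (t x y) = t2 (ψ x) (φ y) := by
    intro x y
    have : e.symm (t x y) = TensorProduct.tmul ℝ x y := by
      rw [LinearEquiv.symm_apply_eq]
      simp [e]
    simp [J, this]
  have := i1.1
  apply AA.of_iso (J.restrictScalars ℤ)
  · intro x hx y hy
    change inner ℝ (J x) (J y) = inner ℝ x y
    induction hx, hy using Submodule.span_induction₂ with
    | mem_mem x y hx hy =>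
      obtain ⟨x, hx, x', hx', rfl⟩ := hx
      obtain ⟨y, hy, y', hy', rfl⟩ := hy
      dsimp only
      rw [hJ, hJ, ht2.2, ht.2, f7 x hx y hy, g7 x' hx' y' hy']
    | zero_left y hy => simp
    | zero_right y hy => simp
    | add_left x y z _ _ _ h1 h2 => rw [map_add, inner_add_left, inner_add_left, h1, h2]
    | add_right x y z _ _ _ h1 h2 => rw [map_add, inner_add_right, inner_add_right, h1, h2]
    | smul_left r x y _ _ h1 =>
      rw [← Int.cast_smul_eq_zsmul ℝ, map_smul, real_inner_smul_left, real_inner_smul_left, h1]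
    | smul_right r x y _ _ h1 =>
      rw [← Int.cast_smul_eq_zsmul ℝ, map_smul, real_inner_smul_right, real_inner_smul_right, h1]
  · apply hAT.mono
    rw [tensorLat, Submodule.map_span, Submodule.span_le]
    rintro _ ⟨_, ⟨x, hx, y, hy, rfl⟩, rfl⟩
    change J (t x y) ∈ _
    rw [hJ]
    exact mem_tensorLat (f6 x hx) (g6 y hy)

theorem AA_all (H : HypH.{uu, vv}) (ht : IsTensor t) {N : Submodule ℤ E} {M : Submodule ℤ F} {a b : ℝ}
    (hN : IsLt N) (ha : 0 ≤ a) (hA : AA N a) (hM : IsLt M) (hb : 0 ≤ b) (hB : AA M b) :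
    AA (tensorLat t N M) (a * b) := by
  have key := devissage (flip_tensor ht) hN ha (fun M b hM hb hB hd h0' => by
    rw [flip_lat, mul_comm]
    exact devissage ht hM hb.le (fun N a hN ha hA hc h0 =>
      ss_case H ht hN ha hA hc h0 hM hb hB hd h0') _ N hN rfl a ha hA) _ M hM rfl b hb hB
  rwa [flip_lat, mul_comm] at key

theorem Hmin_trivial {V : Type*} [NormedAddCommGroup V] [InnerProductSpace ℝ V] [Subsingleton V]
    (L : Submodule ℤ V) : Hmin L = 0 := by
  rw [Hmin]
  convert Real.sInf_empty
  rw [Set.eq_empty_iff_forall_notMem]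
  rintro _ ⟨F, hF, -⟩
  exact hF (Subsingleton.elim _ _)

theorem main_thm (H : HypH.{uu, vv}) (ht : IsTensor t) {L : Submodule ℤ E} {M : Submodule ℤ F}
    (hL : IsLat L) (hM : IsLat M) : Hmin (tensorLat t L M) = Hmin L * Hmin M := by
  obtain ⟨hL1, hL2⟩ := isLat_isLt hL
  obtain ⟨hM1, hM2⟩ := isLat_isLt hM
  have := fd_tensor ht
  have hG : finrank ℝ G = finrank ℝ E * finrank ℝ F := by
    rw [← (LinearEquiv.ofBijective _ ht.1).finrank_eq, finrank_tensorProduct]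
  have hrL : finrank ℝ E = rk L := by rw [← hL1.2, hL2, finrank_top]
  have hrM : finrank ℝ F = rk M := by rw [← hM1.2, hM2, finrank_top]
  by_cases h0 : rk L = 0
  · have : Subsingleton E := finrank_zero_iff.1 (hrL.trans h0)
    have : Subsingleton G := finrank_zero_iff.1 (by rw [hG, hrL, h0, zero_mul])
    rw [Hmin_trivial, Hmin_trivial L, zero_mul]
  by_cases h0' : rk M = 0
  · have : Subsingleton F := finrank_zero_iff.1 (hrM.trans h0')
    have : Subsingleton G := finrank_zero_iff.1 (by rw [hG, hrM, h0', mul_zero])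
    rw [Hmin_trivial, Hmin_trivial M, mul_zero]
  obtain ⟨hT1, hT2, -⟩ := tensor_info ht hL1 hM1
  have hT0 : rk (tensorLat t L M) ≠ 0 := by
    rw [hT2]
    exact Nat.mul_ne_zero h0 h0'
  apply le_antisymm
  · -- the easy inequality
    set c := Hmin (tensorLat t L M) with hc
    have hAc : AA (tensorLat t L M) c := AA_Hmin hT1
    have key : ∀ (F1 : Submodule ℝ E) (F2 : Submodule ℝ F), F1 ≠ ⊥ → IsRational L F1 → F2 ≠ ⊥ →
        IsRational M F2 → c ≤ Hr L F1 * Hr M F2 := by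
      intro F1 F2 n1 r1 n2 r2
      have hl1 := hL1.sub (X := L ⊓ rz F1) inf_le_left
      have hm1 := hM1.sub (X := M ⊓ rz F2) inf_le_left
      have p1 := Hr_pos hL1 r1
      have p2 := Hr_pos hM1 r2
      have q1 := rk_ne_zero hL1 r1 n1
      have q2 := rk_ne_zero hM1 r2 n2
      obtain ⟨-, s2, s3⟩ := tensor_info ht hl1 hm1
      have := hAc (tensorLat t (L ⊓ rz F1) (M ⊓ rz F2)) (tensorLat_mono inf_le_left inf_le_left)
      rw [s2, s3, ← Hr_pow hL1 r1 n1, ← Hr_pow hM1 r2 n2, ← pow_mul, ← pow_mul,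
        mul_comm (rk (M ⊓ rz F2)), ← mul_pow] at this
      exact le_of_pow_le_pow_left₀ (Nat.mul_ne_zero q1 q2) (by positivity) this
    have step : ∀ F2 : Submodule ℝ F, F2 ≠ ⊥ → IsRational M F2 → c ≤ Hmin L * Hr M F2 := by
      intro F2 n2 r2
      have p2 := Hr_pos hM1 r2
      rw [← div_le_iff₀ p2]
      apply le_csInf
      · exact ⟨_, sp L, sp_ne_bot hL1 le_rfl h0, rational_sp le_rfl, rfl⟩
      · rintro _ ⟨F1, n1, r1, rfl⟩
        rw [div_le_iff₀ p2]
        exact key F1 F2 n1 r1 n2 r2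
    rcases (Hmin_nonneg hL1).eq_or_lt with h | h
    · have := step (sp M) (sp_ne_bot hM1 le_rfl h0') (rational_sp le_rfl)
      rwa [← h, zero_mul] at this ⊢
    · rw [← div_le_iff₀' h]
      apply le_csInf
      · exact ⟨_, sp M, sp_ne_bot hM1 le_rfl h0', rational_sp le_rfl, rfl⟩
      · rintro _ ⟨F2, n2, r2, rfl⟩
        rw [div_le_iff₀' h]
        exact step F2 n2 r2
  · exact (AA_all H ht hL1 (Hmin_nonneg hL1) (AA_Hmin hL1) hM1 (Hmin_nonneg hM1)
      (AA_Hmin hM1)).le_Hmin hT1 hT0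

end

/-- If tensor multiplicativity of `H_min` holds for all pairs of semistable
isodual Euclidean lattices, then it holds for all pairs of Euclidean lattices. -/
theorem statement13.{u, v}
    (H : ∀ (E : Type u) (F : Type u) [NormedAddCommGroup E] [InnerProductSpace ℝ E]
      [FiniteDimensional ℝ E] [NormedAddCommGroup F] [InnerProductSpace ℝ F]
      [FiniteDimensional ℝ F] (L : Submodule ℤ E) (M : Submodule ℤ F),
      IsLat L → IsLat M → Semistable L → Semistable M →
      (∃ τ : E →ₗ[ℝ] E, IsIsodual L τ) → (∃ υ : F →ₗ[ℝ] F, IsIsodual M υ) →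
      ∀ (G : Type v) [NormedAddCommGroup G] [InnerProductSpace ℝ G]
        (tp : E →ₗ[ℝ] F →ₗ[ℝ] G), IsTensor tp →
        Hmin (tensorLat tp L M) = Hmin L * Hmin M) :
    ∀ (E : Type u) (F : Type u) [NormedAddCommGroup E] [InnerProductSpace ℝ E]
      [FiniteDimensional ℝ E] [NormedAddCommGroup F] [InnerProductSpace ℝ F]
      [FiniteDimensional ℝ F] (L : Submodule ℤ E) (M : Submodule ℤ F),
      IsLat L → IsLat M →
      ∀ (G : Type v) [NormedAddCommGroup G] [InnerProductSpace ℝ G]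
        (tp : E →ₗ[ℝ] F →ₗ[ℝ] G), IsTensor tp →
        Hmin (tensorLat tp L M) = Hmin L * Hmin M := by
  intro E F _ _ _ _ _ _ L M hL hM G _ _ tp ht
  exact main_thm H ht hL hM

end EucLat
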